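/- The family gamma -> (1/(T^2-T) - gamma omega)/(1/(T^2-T) - gamma(alpha omega)), indexed by Gamma~ = Gamma/{±I}, is multipliable, and its product u_alpha(1/(T^2-T)) satisfies |u_alpha(1/(T^2-T)) - pi^3| < 3^{-5}, where pi = 1/T. (Part of the Proposition in Section 8.2 of the paper; this is the value at the cusp 1/(T^2-T).) -/

import Mathlib

open Polynomial Matrix
open scoped Classical

/-- The absolute value on `K_∞ = F₃((π))`: `|x| = 3^{-v_∞(x)}`. -/
noncomputable def absK3 (x : LaurentSeries (ZMod 3)) : ℝ :=
  if x = 0 then 0 else (3 : ℝ) ^ (-(HahnSeries.order x))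

/-- The element `T = π⁻¹` of `K_∞ = F₃((π))`. -/
noncomputable def Tel3 : LaurentSeries (ZMod 3) :=
  HahnSeries.single (-1 : ℤ) 1

/-- The embedding `A = F₃[T] → C`, sending `T` to `π⁻¹`. -/
noncomputable def polyEmb3 (C : Type*) [NormedField C]
    [Algebra (LaurentSeries (ZMod 3)) C] : Polynomial (ZMod 3) →+* C :=
  (algebraMap (LaurentSeries (ZMod 3)) C).comp (Polynomial.aeval Tel3).toRingHom

/-- The action of a matrix over `A = F₃[T]` on `C` by fractional linear
transformations. -/
noncomputable def act3 {C : Type*} [NormedField C] [Algebra (LaurentSeries (ZMod 3)) C]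
    (g : Matrix (Fin 2) (Fin 2) (Polynomial (ZMod 3))) (z : C) : C :=
  (polyEmb3 C (g 0 0) * z + polyEmb3 C (g 0 1)) /
    (polyEmb3 C (g 1 0) * z + polyEmb3 C (g 1 1))

/-- `Γ = Γ₀(T³-T²) = {[[a,b],[c,d]] : a,b,c,d ∈ F₃[T], ad-bc ∈ F₃ˣ, (T³-T²) ∣ c}`. -/
def Gamma0TTT : Set (Matrix (Fin 2) (Fin 2) (Polynomial (ZMod 3))) :=
  {g | (∃ u : ZMod 3, u ≠ 0 ∧ g.det = Polynomial.C u) ∧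
    ((Polynomial.X : Polynomial (ZMod 3)) ^ 3 - Polynomial.X ^ 2) ∣ g 1 0}

/-- The matrix `α = [[T³+2T²+2T+2, 2T+1],[T⁴+T³+T², 2T²+2T+1]] ∈ Γ₀(T³-T²)`. -/
noncomputable def alpha3 : Matrix (Fin 2) (Fin 2) (Polynomial (ZMod 3)) :=
  !![Polynomial.X ^ 3 + 2 * Polynomial.X ^ 2 + 2 * Polynomial.X + 2, 2 * Polynomial.X + 1;
     Polynomial.X ^ 4 + Polynomial.X ^ 3 + Polynomial.X ^ 2, 2 * Polynomial.X ^ 2 + 2 * Polynomial.X + 1]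

/-- The equivalence relation on `Γ` identifying `γ` and `-γ`;  the quotient
`Quotient pmSetoid` is `Γ~ = Γ/{±I}`. -/
def pmSetoid : Setoid ↥Gamma0TTT where
  r γ δ := δ.val = γ.val ∨ δ.val = -γ.val
  iseqv := by
    constructor
    · intro γ
      exact Or.inl rfl
    · rintro γ δ (h | h)
      · exact Or.inl h.symm
      · exact Or.inr (by rw [h, neg_neg])
    · rintro γ δ ε (h | h) (h' | h')
      · exact Or.inl (h'.trans h)
      · exact Or.inr (by rw [h', h])
      · exact Or.inr (h'.trans h)
      · exact Or.inl (by rw [h', h, neg_neg])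

/-- Sum of coefficient lists modulo 3. -/
def addL : List ℕ → List ℕ → List ℕ
  | [], b => b
  | x :: a, [] => x :: a
  | x :: a, y :: b => (x + y) % 3 :: addL a b

/-- Scalar multiple of a coefficient list modulo 3. -/
def smulL (r : ℕ) : List ℕ → List ℕ
  | [] => []
  | x :: a => r * x % 3 :: smulL r a

/-- Product of coefficient lists modulo 3. -/
def mulL : List ℕ → List ℕ → List ℕ
  | [], _ => []
  | x :: a, b => addL (smulL x b) (0 :: mulL a b)

/-- Difference of coefficient lists modulo 3. -/
def subL (a b : List ℕ) : List ℕ := addL a (smulL 2 b)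

/-- Whether all the coefficients vanish modulo 3. -/
def isZeroL : List ℕ → Bool
  | [] => true
  | x :: a => (x % 3 == 0) && isZeroL a

/-- Whether two coefficient lists agree modulo 3. -/
def eqL (a b : List ℕ) : Bool := isZeroL (subL a b)

/-- Evaluation of `p` at the list of digits of `l` modulo 3; it makes the kernel evaluate the
digits once instead of at every use. -/
def withDigits : List ℕ → (List ℕ → Bool) → Bool
  | [], p => p []
  | x :: a, p => withDigits a fun a' =>
      match x % 3 with
      | 0 => p (0 :: a')
      | 1 => p (1 :: a')
      | _ => p (2 :: a')

/-- Whether `p` holds for all lists of length `n` of digits below 3. -/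
def allL : ℕ → (List ℕ → Bool) → Bool
  | 0, p => p []
  | n + 1, p => allL n fun l => p (0 :: l) && p (1 :: l) && p (2 :: l)

/-- Whether `p` holds for the list of `n` lowest coefficients of the power series `r / v`, where `v`
has constant coefficient 1, as soon as this list is an exact quotient. -/
def quotL (v : List ℕ) : ℕ → List ℕ → (List ℕ → Bool) → Bool
  | 0, r, p => !isZeroL r || p []
  | n + 1, r, p => withDigits (r.take 1) fun q =>
      withDigits (subL r (mulL q v)) fun r' =>
        quotL v n (r'.drop 1) fun l => p ((q ++ [0]).take 1 ++ l)

/-- The matrix with rows `(a, b)` and `((T³ - T²) c, d)`, by coefficient lists. -/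
structure Code where
  (a b c d : List ℕ)

/-- The coefficients of the first entry of `(T (T - 1) p, q) α`, divided by `T (T - 1)`. -/
def fstL (p q : List ℕ) : List ℕ := addL (mulL p [2, 2, 2, 1]) (mulL q [0, 2, 1])

/-- The coefficients of the second entry of `(T (T - 1) p, q) α`. -/
def sndL (p q : List ℕ) : List ℕ :=
  addL (mulL (mulL [0, 2, 1] p) [1, 2]) (mulL q [1, 2, 2])

def Code.p (g : Code) : List ℕ := subL (0 :: g.c) g.a

def Code.q (g : Code) : List ℕ := subL g.d (mulL [0, 2, 1] g.b)

def codes : List Code := [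
  ⟨[2], [2, 2], [], [1]⟩,
  ⟨[2], [2, 1], [], [1]⟩,
  ⟨[2], [2], [], [1]⟩,
  ⟨[2], [1, 1], [], [1]⟩,
  ⟨[2], [1], [], [1]⟩,
  ⟨[2], [1, 2], [], [1]⟩,
  ⟨[2], [], [], [1]⟩,
  ⟨[2], [0, 2], [], [1]⟩,
  ⟨[2], [0, 1], [], [1]⟩,
  ⟨[1], [1, 1], [], [1]⟩,
  ⟨[1], [1], [], [1]⟩,
  ⟨[1], [1, 2], [], [1]⟩,
  ⟨[1], [], [], [1]⟩,
  ⟨[1], [0, 2], [], [1]⟩,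
  ⟨[1], [0, 1], [], [1]⟩,
  ⟨[1], [2, 2], [], [1]⟩,
  ⟨[1], [2, 1], [], [1]⟩,
  ⟨[1], [2], [], [1]⟩,
  ⟨[2], [], [1], [1]⟩,
  ⟨[1], [], [1], [1]⟩,
  ⟨[2], [], [2], [1]⟩,
  ⟨[1], [], [2], [1]⟩,
  ⟨[2, 2], [1], [1], [1, 2, 2]⟩,
  ⟨[1, 1], [2], [1], [1, 2, 2]⟩,
  ⟨[2, 0, 2], [1, 1], [2], [1, 0, 1]⟩,
  ⟨[1, 0, 1], [2, 2], [2], [1, 0, 1]⟩,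
  ⟨[2, 2], [2], [2], [1, 2, 2]⟩,
  ⟨[1, 2, 1], [2], [2, 1], [1, 1, 2]⟩,
  ⟨[2, 2, 1], [1], [2, 1], [1, 2, 1]⟩,
  ⟨[1, 1, 2], [1], [1, 2], [1, 2, 1]⟩,
  ⟨[2, 1, 2], [2], [1, 2], [1, 1, 2]⟩,
  ⟨[1, 0, 1], [1, 2], [0, 1], [1, 0, 2, 2]⟩,
  ⟨[2, 1, 2], [0, 1], [0, 1], [1, 1, 0, 2]⟩,
  ⟨[1, 2, 1], [0, 2], [0, 1], [1, 1, 0, 2]⟩,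
  ⟨[2, 2, 2, 2], [2, 2, 1], [0, 2], [1, 2, 0, 1]⟩,
  ⟨[1, 1, 1, 1], [1, 1, 2], [0, 2], [1, 2, 0, 1]⟩,
  ⟨[2, 2, 1], [0, 2], [1, 1], [1, 2, 2, 2]⟩,
  ⟨[1, 2, 2], [0, 1], [2, 2], [1, 1, 2, 1]⟩,
  ⟨[2, 1, 1], [1, 2], [2, 1], [1, 1, 1, 2]⟩,
  ⟨[2, 1, 0, 2, 2], [0, 1, 2, 1], [2, 1], [1, 1, 1, 2]⟩,
  ⟨[2, 1, 2, 1, 1], [2, 0, 1, 2], [2, 1], [1, 1, 1, 2]⟩,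
  ⟨[1, 2, 2], [2, 1], [2, 1], [1, 1, 1, 2]⟩,
  ⟨[1, 2, 1, 2, 2], [1, 0, 2, 1], [2, 1], [1, 1, 1, 2]⟩,
  ⟨[1, 2, 0, 1, 1], [0, 2, 1, 2], [2, 1], [1, 1, 1, 2]⟩,
  ⟨[2, 1, 1], [1, 2], [0, 0, 2], [1, 1, 2, 0, 1]⟩,
  ⟨[1, 2, 2], [2, 1], [0, 0, 2], [1, 1, 2, 0, 1]⟩,
  ⟨[2, 2, 1, 2], [0, 0, 1], [0, 1, 2], [1, 2, 2, 2, 1]⟩,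
  ⟨[1, 1, 0, 2], [2, 1, 1], [2, 0, 2], [1, 2, 0, 0, 1]⟩,
  ⟨[2, 0, 1, 1], [2, 1, 2], [1, 1, 1], [1, 0, 0, 2, 2]⟩,
  ⟨[1, 0, 2, 1], [1, 0, 2], [1, 2, 1], [1, 0, 0, 1, 2]⟩,
  ⟨[2, 1, 1], [1, 2], [1, 2, 1], [1, 1, 0, 1, 2]⟩,
  ⟨[1, 2, 2], [2, 1], [1, 2, 1], [1, 1, 0, 1, 2]⟩,
  ⟨[2, 2, 0, 2, 1], [0, 1, 0, 2], [0, 0, 2, 1], [1, 2, 1, 1, 1, 2]⟩,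
  ⟨[1, 0, 1, 1, 2], [0, 1, 0, 1], [0, 0, 1, 2], [1, 0, 2, 2, 2, 1]⟩,
  ⟨[2, 2, 2, 2, 2], [0, 2, 2, 1], [0, 2, 2, 2], [1, 2, 0, 0, 1, 1]⟩,
  ⟨[2, 0, 0, 1, 1], [2, 2, 1, 2], [1, 0, 1, 1], [1, 0, 2, 1, 2, 2]⟩,
  ⟨[2, 1, 2, 0, 2], [1, 1, 1, 1], [2, 2, 0, 2], [1, 1, 2, 0, 0, 1]⟩,
  ⟨[1, 1, 0, 2, 1], [1, 1, 0, 2], [1, 2, 2, 1], [1, 2, 0, 2, 1, 2]⟩,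
  ⟨[2, 1, 0, 0, 1], [1, 0, 2, 2], [2, 0, 0, 1], [1, 1, 0, 1, 0, 2]⟩,
  ⟨[2, 0, 2, 1, 2], [2, 0, 0, 1], [1, 2, 1, 2], [1, 0, 1, 0, 2, 1]⟩]

/-- Whether the four coefficient lists come from one of the listed matrices. -/
def isListed (c d m n : List ℕ) : Bool :=
  codes.any fun g => eqL c g.c && (eqL d g.d && (eqL m (fstL g.p g.q) && eqL n (sndL g.p g.q)))

def searchLower (k l : ℕ) : Bool :=
  allL k fun c => allL k fun d => withDigits (fstL (0 :: c) (1 :: d)) fun v =>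
    withDigits (sndL (0 :: c) (1 :: d)) fun w => allL l fun n =>
      !((n.sum + d.sum + 2) % 3 == 0) || (withDigits (mulL (1 :: n) v) fun r =>
        (quotL w (l + 1) (addL [1] r) fun m => isListed c (1 :: d) m (1 :: n)) &&
        (quotL w (l + 1) (addL [2] r) fun m => isListed c (1 :: d) m (1 :: n)))

def searchUpper (k l : ℕ) (u : ℕ) : Bool :=
  allL l fun m => allL l fun n =>
    withDigits (smulL u (subL (mulL (u :: m) [1, 2, 2]) (mulL (1 :: n) [0, 2, 1]))) fun v =>
    withDigits (smulL u (subL (mulL (mulL [0, 2, 1] (u :: m)) [1, 2]) (mulL (1 :: n) [2, 2, 2, 1])))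
      fun w => allL k fun c => quotL v (k + 1) (subL [1] (mulL (0 :: c) w)) fun d =>
        !((n.sum + d.sum + 1) % 3 == 0) || isListed c d (u :: m) (1 :: n)

/-- The polynomial over `F₃` with a given list of coefficients. -/
noncomputable def ofL : List ℕ → (ZMod 3)[X]
  | [] => 0
  | x :: a => C (x : ZMod 3) + X * ofL a

theorem ofL_addL (a b : List ℕ) : ofL (addL a b) = ofL a + ofL b := by
  induction a generalizing b with
  | nil => simp [addL, ofL]
  | cons x a ih =>
    cases b with
    | nil => simp [addL, ofL]
    | cons y b => simp [addL, ofL, ih]; ring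

theorem ofL_smulL (r : ℕ) (a : List ℕ) : ofL (smulL r a) = C (r : ZMod 3) * ofL a := by
  induction a with
  | nil => simp [smulL, ofL]
  | cons x a ih => simp [smulL, ofL, ih]; ring

theorem ofL_mulL (a b : List ℕ) : ofL (mulL a b) = ofL a * ofL b := by
  induction a with
  | nil => simp [mulL, ofL]
  | cons x a ih => simp [mulL, ofL, ih, ofL_addL, ofL_smulL]; ring

theorem ofL_subL (a b : List ℕ) : ofL (subL a b) = ofL a - ofL b := by
  have h : ((2 : ℕ) : ZMod 3) = -1 := rfl
  simp [subL, ofL_addL, ofL_smulL, h, sub_eq_add_neg, -Nat.cast_ofNat]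

theorem isZeroL_iff (a : List ℕ) : isZeroL a = true ↔ ofL a = 0 := by
  induction a with
  | nil => simp [isZeroL, ofL]
  | cons x a ih =>
    have key : ofL (x :: a) = 0 ↔ (x : ZMod 3) = 0 ∧ ofL a = 0 := by
      constructor
      · intro h
        have h0 : (x : ZMod 3) = 0 := by simpa [ofL] using congrArg (coeff · 0) h
        refine ⟨h0, ?_⟩
        simpa [ofL, h0] using h
      · rintro ⟨h, h'⟩
        simp [ofL, h, h']
    rw [key, ZMod.natCast_eq_zero_iff]
    simp [isZeroL, ih, Nat.dvd_iff_mod_eq_zero]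

theorem eqL_iff (a b : List ℕ) : eqL a b = true ↔ ofL a = ofL b := by
  rw [eqL, isZeroL_iff, ofL_subL, sub_eq_zero]

theorem ofL_map_mod (a : List ℕ) : ofL (a.map (· % 3)) = ofL a := by
  induction a with
  | nil => rfl
  | cons x a ih => simp [ofL, ih]

theorem withDigits_eq (a : List ℕ) (p : List ℕ → Bool) :
    withDigits a p = p (a.map (· % 3)) := by
  induction a generalizing p with
  | nil => rfl
  | cons x a ih =>
    rw [withDigits, ih, List.map_cons]
    have : x % 3 < 3 := Nat.mod_lt _ (by norm_num)
    generalize x % 3 = y at this ⊢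
    interval_cases y <;> rfl

theorem allL_spec {n : ℕ} {p : List ℕ → Bool} (h : allL n p = true) (l : List ℕ)
    (hl : l.length = n) (hd : ∀ x ∈ l, x < 3) : p l = true := by
  induction n generalizing p l with
  | zero => rw [List.length_eq_zero_iff.mp hl]; exact h
  | succ n ih =>
    obtain ⟨x, l, rfl⟩ := List.exists_cons_of_length_eq_add_one hl
    have := ih h l (by simpa using hl) fun y hy => hd y (by simp [hy])
    have hx := hd x (by simp)
    simp only [Bool.and_eq_true] at this
    interval_cases x
    exacts [this.1.1, this.1.2, this.2]

theorem coeff_zero_ofL_cons (x : ℕ) (a : List ℕ) : (ofL (x :: a)).coeff 0 = x := by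
  simp [ofL]

theorem X_mul_ofL_drop_one {a : List ℕ} (h : (ofL a).coeff 0 = 0) :
    X * ofL (a.drop 1) = ofL a := by
  cases a with
  | nil => simp [ofL]
  | cons x a =>
    rw [coeff_zero_ofL_cons] at h
    simp [ofL, h]

theorem natCast_eq_iff_of_lt {x y : ℕ} (hx : x < 3) (hy : y < 3) :
    (x : ZMod 3) = y ↔ x = y := by
  rw [ZMod.natCast_eq_natCast_iff]
  constructor
  · intro h; exact Nat.ModEq.eq_of_lt_of_lt h hx hy
  · rintro rfl; rfl

theorem quotL_spec {v : List ℕ} (hv : (ofL v).coeff 0 = 1) {n : ℕ} {r : List ℕ}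
    {p : List ℕ → Bool} (h : quotL v n r p = true) (l : List ℕ) (hl : l.length = n)
    (hd : ∀ x ∈ l, x < 3) (e : ofL r = ofL l * ofL v) : p l = true := by
  induction n generalizing r p l with
  | zero =>
    rw [List.length_eq_zero_iff.mp hl] at e ⊢
    have : isZeroL r = true := by rw [isZeroL_iff, e]; simp [ofL]
    simpa [quotL, this] using h
  | succ n ih =>
    obtain ⟨x, l, rfl⟩ := List.exists_cons_of_length_eq_add_one hl
    have hx := hd x (by simp)
    have e0 : (ofL r).coeff 0 = x := by
      rw [e, mul_coeff_zero, hv, coeff_zero_ofL_cons, mul_one]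
    obtain ⟨hq, hq'⟩ : ((((r.take 1).map (· % 3)) ++ [0]).take 1 = [x]) ∧
        ofL ((r.take 1).map (· % 3)) = C (x : ZMod 3) := by
      cases r with
      | nil =>
        have : x = 0 := by
          rw [← natCast_eq_iff_of_lt hx (by norm_num), ← e0]; simp [ofL]
        simp [ofL, this]
      | cons y r =>
        rw [coeff_zero_ofL_cons] at e0
        have : y % 3 = x := by
          rw [← natCast_eq_iff_of_lt (Nat.mod_lt _ (by norm_num)) hx, ← e0]; simp
        simp [ofL, this]
    rw [quotL, withDigits_eq, withDigits_eq, hq] at h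
    have e1 : ofL (((subL r (mulL ((r.take 1).map (· % 3)) v))).map (· % 3)) =
        X * (ofL l * ofL v) := by
      rw [ofL_map_mod, ofL_subL, ofL_mulL, hq', e, ofL]; ring
    refine ih h l (by simpa using hl) (fun y hy => hd y (by simp [hy])) ?_
    apply mul_left_cancel₀ (X_ne_zero (R := ZMod 3))
    rw [X_mul_ofL_drop_one (by rw [e1]; simp), e1]

theorem exists_ofL (n : ℕ) (p : (ZMod 3)[X]) (hp : p.degree < n) :
    ∃ l : List ℕ, l.length = n ∧ (∀ x ∈ l, x < 3) ∧ ofL l = p := by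
  induction n generalizing p with
  | zero =>
    have : p = 0 := by simpa using hp
    exact ⟨[], rfl, by simp, by simp [ofL, this]⟩
  | succ n ih =>
    obtain ⟨l, h1, h2, h3⟩ := ih p.divX (by
      rw [degree_lt_iff_coeff_zero] at hp ⊢
      intro m hm
      rw [coeff_divX]
      exact hp _ (by omega))
    refine ⟨(p.coeff 0).val :: l, by simp [h1], ?_, ?_⟩
    · intro x hx
      rcases List.mem_cons.mp hx with rfl | hx
      · exact ZMod.val_lt _
      · exact h2 x hx
    · rw [ofL, h3, ZMod.natCast_zmod_val, add_comm, X_mul_divX_add]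

theorem exists_ofL_cons (n : ℕ) (p : (ZMod 3)[X]) (x : ℕ) (hp : p.degree < (n + 1 : ℕ))
    (h0 : p.coeff 0 = x) :
    ∃ l : List ℕ, l.length = n ∧ (∀ x ∈ l, x < 3) ∧ ofL (x :: l) = p := by
  obtain ⟨l, h1, h2, h3⟩ := exists_ofL (n + 1) p hp
  obtain ⟨y, l, rfl⟩ := List.exists_cons_of_length_eq_add_one h1
  refine ⟨l, by simpa using h1, fun z hz => h2 z (by simp [hz]), ?_⟩
  rw [← h3, coeff_zero_ofL_cons] at h0
  rw [← h3, ofL, ofL, h0]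

theorem eval_one_ofL (a : List ℕ) : (ofL a).eval 1 = (a.sum : ZMod 3) := by
  induction a with
  | nil => simp [ofL]
  | cons x a ih => simp [ofL, ih]

theorem C_two_eq_neg_one : C (2 : ZMod 3) = -1 := by
  rw [show (2 : ZMod 3) = -1 from rfl, C_neg, C_1]

theorem two_eq_neg_one : (2 : (ZMod 3)[X]) = -1 := by
  rw [← C_two_eq_neg_one]; rfl

theorem eq_one_or_eq_two : ∀ {u : ZMod 3}, u ≠ 0 → u = 1 ∨ u = 2 := by decide

theorem ofL_fstL (p q : List ℕ) :
    ofL (fstL p q) = ofL p * (X ^ 3 + 2 * X ^ 2 + 2 * X + 2) + ofL q * (X ^ 2 - X) := by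
  simp only [fstL, ofL_addL, ofL_mulL, ofL]
  simp [C_two_eq_neg_one, two_eq_neg_one]
  ring

theorem ofL_sndL (p q : List ℕ) :
    ofL (sndL p q) = (X ^ 2 - X) * ofL p * (2 * X + 1) + ofL q * (2 * X ^ 2 + 2 * X + 1) := by
  simp only [sndL, ofL_addL, ofL_mulL, ofL]
  simp [C_two_eq_neg_one, two_eq_neg_one]
  ring

theorem searchLower_zero : searchLower 0 5 = true := by decide +kernel
theorem searchLower_one : searchLower 1 4 = true := by decide +kernel
theorem searchLower_two : searchLower 2 3 = true := by decide +kernel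
theorem searchUpper_three_one : searchUpper 3 2 1 = true := by decide +kernel
theorem searchUpper_three_two : searchUpper 3 2 2 = true := by decide +kernel
theorem searchUpper_four_one : searchUpper 4 1 1 = true := by decide +kernel
theorem searchUpper_four_two : searchUpper 4 1 2 = true := by decide +kernel
theorem searchUpper_five_one : searchUpper 5 0 1 = true := by decide +kernel
theorem searchUpper_five_two : searchUpper 5 0 2 = true := by decide +kernel

theorem isListed_of_searchLower {k l : ℕ} (h : searchLower k l = true) (c d m n : List ℕ)
    (hc : c.length = k ∧ ∀ x ∈ c, x < 3) (hd : d.length = k ∧ ∀ x ∈ d, x < 3)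
    (hm : m.length = l + 1 ∧ ∀ x ∈ m, x < 3) (hn : n.length = l ∧ ∀ x ∈ n, x < 3)
    (hs : (n.sum + d.sum + 2) % 3 = 0) (u : ZMod 3) (hu : u ≠ 0)
    (e : ofL m * ofL (sndL (0 :: c) (1 :: d)) -
      ofL (1 :: n) * ofL (fstL (0 :: c) (1 :: d)) = C u) :
    isListed c (1 :: d) m (1 :: n) = true := by
  have h1 := allL_spec (allL_spec h c hc.1 hc.2) d hd.1 hd.2
  rw [withDigits_eq, withDigits_eq] at h1
  have h2 := allL_spec h1 n hn.1 hn.2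
  rw [withDigits_eq] at h2
  simp only [hs, beq_self_eq_true, Bool.not_true, Bool.false_or, Bool.and_eq_true] at h2
  have hw : (ofL ((sndL (0 :: c) (1 :: d)).map (· % 3))).coeff 0 = 1 := by
    rw [ofL_map_mod, ofL_sndL]
    simp [ofL, mul_coeff_zero]
  rcases eq_one_or_eq_two hu with rfl | rfl
  · refine quotL_spec hw h2.1 m hm.1 hm.2 ?_
    simp only [ofL_addL, ofL_map_mod, ofL_mulL]
    rw [eq_add_of_sub_eq e]
    simp [ofL]
  · refine quotL_spec hw h2.2 m hm.1 hm.2 ?_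
    simp only [ofL_addL, ofL_map_mod, ofL_mulL]
    rw [eq_add_of_sub_eq e]
    simp [ofL]

theorem isListed_of_searchUpper {k l u : ℕ} (h : searchUpper k l u = true) (c d m n : List ℕ)
    (hc : c.length = k ∧ ∀ x ∈ c, x < 3) (hd : d.length = k + 1 ∧ ∀ x ∈ d, x < 3)
    (hm : m.length = l ∧ ∀ x ∈ m, x < 3) (hn : n.length = l ∧ ∀ x ∈ n, x < 3)
    (hs : (n.sum + d.sum + 1) % 3 = 0) (hu : (u : ZMod 3) * u = 1)
    (e : ofL (u :: m) * ofL (sndL (0 :: c) d) -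
      ofL (1 :: n) * ofL (fstL (0 :: c) d) = C (u : ZMod 3)) :
    isListed c d (u :: m) (1 :: n) = true := by
  have h1 := allL_spec (allL_spec h m hm.1 hm.2) n hn.1 hn.2
  rw [withDigits_eq, withDigits_eq] at h1
  have h2 := allL_spec h1 c hc.1 hc.2
  have hu2 : C (u : ZMod 3) * C (u : ZMod 3) = 1 := by rw [← C_mul, hu, C_1]
  have h3 := quotL_spec (v := _) ?_ h2 d hd.1 hd.2 ?_
  · simpa [hs] using h3
  · rw [ofL_map_mod]
    simp [ofL_smulL, ofL_subL, ofL_mulL, mul_coeff_zero, coeff_zero_ofL_cons, hu]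
  · rw [ofL_fstL, ofL_sndL] at e
    simp only [ofL_map_mod, ofL_smulL, ofL_subL, ofL_mulL] at e ⊢
    rw [show ofL [1] = 1 by simp [ofL], ← hu2]
    nth_rewrite 2 [← e]
    simp only [ofL]
    simp [C_two_eq_neg_one, two_eq_neg_one]
    ring

/-- All solutions of `m w - n v = u` of small degree, where `(T (T - 1) v, w)` is the row vector
`(T² (T - 1) c, d) α`, come from the listed matrices. -/
theorem exists_mem_codes {c d m n : (ZMod 3)[X]} {u : ZMod 3} (hu : u ≠ 0) {k l : ℕ}
    (hkl : k + l ≤ 5) (hc : c.degree < k) (hd : d.degree < (k + 1 : ℕ))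
    (hm : m.degree < (l + 1 : ℕ)) (hn : n.degree < (l + 1 : ℕ))
    (hd0 : d.coeff 0 = 1) (hn0 : n.coeff 0 = 1) (hs : n.eval 1 + d.eval 1 = 0)
    (e : m * ((X ^ 2 - X) * (X * c) * (2 * X + 1) + d * (2 * X ^ 2 + 2 * X + 1)) -
      n * (X * c * (X ^ 3 + 2 * X ^ 2 + 2 * X + 2) + d * (X ^ 2 - X)) = C u) :
    ∃ g ∈ codes, c = ofL g.c ∧ d = ofL g.d ∧ m = ofL (fstL g.p g.q) ∧
      n = ofL (sndL g.p g.q) := by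
  wlog hkl' : k + l = 5 generalizing l
  · obtain ⟨j, hj⟩ := Nat.exists_eq_add_of_le hkl
    exact this (l := l + j) (by omega)
      (hm.trans_le (by norm_cast; omega)) (hn.trans_le (by norm_cast; omega)) (by omega)
  have hm0 : m.coeff 0 = u := by
    simpa [mul_coeff_zero, hd0] using congrArg (coeff · 0) e
  obtain ⟨c, hcl, hcd, rfl⟩ := exists_ofL k c hc
  obtain ⟨n, hnl, hnd, rfl⟩ := exists_ofL_cons l n 1 hn (by simpa using hn0)
  suffices ∃ d' m', d = ofL d' ∧ m = ofL m' ∧ isListed c d' m' (1 :: n) = true by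
    obtain ⟨d, m, rfl, rfl, h⟩ := this
    simp only [isListed, List.any_eq_true, Bool.and_eq_true, eqL_iff] at h
    exact h
  have hXc : X * ofL c = ofL (0 :: c) := by simp [ofL]
  rw [hXc] at e
  by_cases hk : k < 3
  · obtain ⟨d, hdl, hdd, rfl⟩ := exists_ofL_cons k d 1 hd (by simpa using hd0)
    obtain ⟨m, hml, hmd, rfl⟩ := exists_ofL (l + 1) m hm
    refine ⟨_, _, rfl, rfl, ?_⟩
    rw [← ofL_fstL, ← ofL_sndL] at e
    have key : searchLower k l = true := by
      interval_cases k
      · obtain rfl : l = 5 := by omega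
        exact searchLower_zero
      · obtain rfl : l = 4 := by omega
        exact searchLower_one
      · obtain rfl : l = 3 := by omega
        exact searchLower_two
    refine isListed_of_searchLower key c d m n ⟨hcl, hcd⟩ ⟨hdl, hdd⟩ ⟨hml, hmd⟩ ⟨hnl, hnd⟩ ?_ u hu e
    rw [← Nat.dvd_iff_mod_eq_zero, ← ZMod.natCast_eq_zero_iff, ← hs, eval_one_ofL, eval_one_ofL]
    push_cast [List.sum_cons]
    ring
  · obtain ⟨d, hdl, hdd, rfl⟩ := exists_ofL (k + 1) d hd
    obtain ⟨m, hml, hmd, rfl⟩ := exists_ofL_cons l m u.val hm (by simpa using hm0)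
    refine ⟨_, _, rfl, rfl, ?_⟩
    rw [← ofL_fstL, ← ofL_sndL] at e
    have key : searchUpper k l u.val = true := by
      have hk3 : 3 ≤ k := by omega
      have hk5 : k ≤ 5 := by omega
      interval_cases k
      · obtain rfl : l = 2 := by omega
        rcases eq_one_or_eq_two hu with rfl | rfl
        exacts [searchUpper_three_one, searchUpper_three_two]
      · obtain rfl : l = 1 := by omega
        rcases eq_one_or_eq_two hu with rfl | rfl
        exacts [searchUpper_four_one, searchUpper_four_two]
      · obtain rfl : l = 0 := by omega
        rcases eq_one_or_eq_two hu with rfl | rfl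
        exacts [searchUpper_five_one, searchUpper_five_two]
    refine isListed_of_searchUpper key c d m n ⟨hcl, hcd⟩ ⟨hdl, hdd⟩ ⟨hml, hmd⟩ ⟨hnl, hnd⟩ ?_ ?_
      (by simpa using e)
    · rw [← Nat.dvd_iff_mod_eq_zero, ← ZMod.natCast_eq_zero_iff, ← hs, eval_one_ofL, eval_one_ofL]
      push_cast [List.sum_cons]
      ring
    · rw [ZMod.natCast_zmod_val]
      rcases eq_one_or_eq_two hu with rfl | rfl <;> rfl

theorem three_eq_zero : (3 : (ZMod 3)[X]) = 0 := by
  linear_combination two_eq_neg_one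

/-- The matrix in `Γ` with given coefficient lists. -/
noncomputable def Code.mat (g : Code) : Matrix (Fin 2) (Fin 2) (ZMod 3)[X] :=
  !![ofL g.a, ofL g.b; (X ^ 3 - X ^ 2) * ofL g.c, ofL g.d]

/-- The lower row of `[[-(T² - T), 1], [0, 1]] γ` is that of `γ`, and this is its upper row. -/
noncomputable def cuspRow (γ : Matrix (Fin 2) (Fin 2) (ZMod 3)[X]) (j : Fin 2) : (ZMod 3)[X] :=
  γ 1 j - (X ^ 2 - X) * γ 0 j

/-- The row vector `(x, y) α`. -/
noncomputable def mulAlpha (v : Fin 2 → (ZMod 3)[X]) (j : Fin 2) : (ZMod 3)[X] :=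
  v 0 * alpha3 0 j + v 1 * alpha3 1 j

theorem mulAlpha_zero (v : Fin 2 → (ZMod 3)[X]) : mulAlpha v 0 =
    v 0 * (X ^ 3 + 2 * X ^ 2 + 2 * X + 2) + v 1 * (X ^ 4 + X ^ 3 + X ^ 2) := by
  simp [mulAlpha, alpha3]

theorem mulAlpha_one (v : Fin 2 → (ZMod 3)[X]) : mulAlpha v 1 =
    v 0 * (2 * X + 1) + v 1 * (2 * X ^ 2 + 2 * X + 1) := by
  simp [mulAlpha, alpha3]

theorem det_alpha3 : (X ^ 3 + 2 * X ^ 2 + 2 * X + 2) * (2 * X ^ 2 + 2 * X + 1) -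
    (2 * X + 1) * (X ^ 4 + X ^ 3 + X ^ 2) = (-1 : (ZMod 3)[X]) := by
  linear_combination (X ^ 4 + 2 * X ^ 3 + 3 * X ^ 2 + 2 * X + 1) * three_eq_zero

theorem X_sq_sub_X_ne_zero : (X ^ 2 - X : (ZMod 3)[X]) ≠ 0 := by
  intro h
  simpa [coeff_X] using congrArg (coeff · 2) h

theorem degree_lt_of_natDegree_mul_le {p q : (ZMod 3)[X]} (hq : q ≠ 0) {i j : ℕ}
    (h : (q * p).natDegree ≤ i) (hij : i < q.natDegree + j) : p.degree < j := by
  by_cases hp : p = 0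
  · simp [hp]
  · rw [natDegree_mul hq hp] at h
    rw [degree_eq_natDegree hp]
    exact_mod_cast (by omega : p.natDegree < j)

theorem natDegree_X_sq_sub_X : (X ^ 2 - X : (ZMod 3)[X]).natDegree = 2 := by
  compute_degree!

theorem natDegree_X_cube_sub_X_sq : (X ^ 3 - X ^ 2 : (ZMod 3)[X]).natDegree = 3 := by
  compute_degree!

theorem exists_eq_mat {γ : Matrix (Fin 2) (Fin 2) (ZMod 3)[X]} (hγ : γ ∈ Gamma0TTT)
    (h0 : (γ 1 1).coeff 0 = 1) {k l : ℕ} (hkl : k + l ≤ 5)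
    (hc : (γ 1 0).natDegree ≤ k + 2) (hd : (X ^ 2 * γ 1 1).natDegree ≤ k + 2)
    (hm : (mulAlpha (cuspRow γ) 0).natDegree ≤ l + 2)
    (hn : (X ^ 2 * mulAlpha (cuspRow γ) 1).natDegree ≤ l + 2) :
    ∃ g ∈ codes, γ = g.mat := by
  obtain ⟨⟨u, hu, hdet⟩, c, hcd⟩ := hγ
  rw [Matrix.det_fin_two] at hdet
  set a := γ 0 0 with ha
  set b := γ 0 1 with hb
  set d := γ 1 1 with hd'
  set p := X * c - a with hp
  set q := d - (X ^ 2 - X) * b with hq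
  set m := p * (X ^ 3 + 2 * X ^ 2 + 2 * X + 2) + q * (X ^ 2 - X) with hm'
  set n := (X ^ 2 - X) * p * (2 * X + 1) + q * (2 * X ^ 2 + 2 * X + 1) with hn'
  have hM : mulAlpha (cuspRow γ) 0 = (X ^ 2 - X) * m := by
    rw [mulAlpha_zero, cuspRow, cuspRow, ← ha, ← hb, ← hd', hcd]
    linear_combination q * X ^ 3 * three_eq_zero
  have hN : mulAlpha (cuspRow γ) 1 = n := by
    rw [mulAlpha_one, cuspRow, cuspRow, ← ha, ← hb, ← hd', hcd]
    ring
  have ha0 : a.coeff 0 = u := by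
    have := congrArg (coeff · 0) hdet
    simpa [hcd, mul_coeff_zero, h0] using this
  rw [hM] at hm
  rw [hN] at hn
  rw [hcd] at hc
  have hX : (X : (ZMod 3)[X]) ^ 2 ≠ 0 := pow_ne_zero _ X_ne_zero
  have hX3 : (X ^ 3 - X ^ 2 : (ZMod 3)[X]) ≠ 0 := by
    intro h; simpa [h] using natDegree_X_cube_sub_X_sq
  obtain ⟨g, hg, h1, h2, h3, h4⟩ := exists_mem_codes (c := c) (d := d) (m := m) (n := n) hu hkl
    (degree_lt_of_natDegree_mul_le hX3 hc (by rw [natDegree_X_cube_sub_X_sq]; omega))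
    (degree_lt_of_natDegree_mul_le hX hd (by rw [natDegree_X_pow]; omega))
    (degree_lt_of_natDegree_mul_le X_sq_sub_X_ne_zero hm (by rw [natDegree_X_sq_sub_X]; omega))
    (degree_lt_of_natDegree_mul_le hX hn (by rw [natDegree_X_pow]; omega))
    h0 (by simp [hn', hq, mul_coeff_zero, h0])
    (by
      simp only [hn', hq, eval_add, eval_mul, eval_sub, eval_pow, eval_X, eval_ofNat, eval_one]
      linear_combination (2 * eval 1 d) * (by rfl : (3 : ZMod 3) = 0))
    (by
      rw [← hdet, hcd]
      linear_combination (p * d - X * c * q) * det_alpha3 +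
        (p * d - X * c * q) * (2 * X + 1) * X ^ 3 * three_eq_zero)
  refine ⟨g, hg, ?_⟩
  rw [ofL_fstL, hm'] at h3
  rw [ofL_sndL, hn'] at h4
  have h5 : p = ofL g.p := by
    linear_combination (X ^ 2 - X) * h4 - (2 * X ^ 2 + 2 * X + 1) * h3 +
      (p - ofL g.p) * (det_alpha3 + (2 * X + 1) * X ^ 3 * three_eq_zero)
  have h6 : q = ofL g.q := by
    linear_combination (X ^ 2 - X) * (2 * X + 1) * h3 - (X ^ 3 + 2 * X ^ 2 + 2 * X + 2) * h4 +
      (q - ofL g.q) * (det_alpha3 + (2 * X + 1) * X ^ 3 * three_eq_zero)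
  have h7 : a = ofL g.a := by
    have : ofL g.p = X * ofL g.c - ofL g.a := by simp [Code.p, ofL_subL, ofL]
    linear_combination X * h1 - h5 - this
  have h8 : b = ofL g.b := by
    have : ofL g.q = ofL g.d - (X ^ 2 - X) * ofL g.b := by
      simp only [Code.q, ofL_subL, ofL_mulL, ofL]
      push_cast
      rw [C_two_eq_neg_one, C_0, C_1]
      ring
    apply mul_left_cancel₀ X_sq_sub_X_ne_zero
    linear_combination h2 - h6 - this
  ext i j
  fin_cases i <;> fin_cases j <;> simp [Code.mat, ← ha, ← hb, ← hd', hcd, h7, h8, h1, h2]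

theorem neg_mem_Gamma0TTT {γ : Matrix (Fin 2) (Fin 2) (ZMod 3)[X]} (hγ : γ ∈ Gamma0TTT) :
    -γ ∈ Gamma0TTT := by
  obtain ⟨⟨u, hu, hdet⟩, h⟩ := hγ
  exact ⟨⟨u, hu, by rw [Matrix.det_neg, hdet]; simp⟩, by simpa using h⟩

theorem coeff_zero_ne_zero {γ : Matrix (Fin 2) (Fin 2) (ZMod 3)[X]}
    (hγ : γ ∈ Gamma0TTT) : (γ 1 1).coeff 0 ≠ 0 := by
  obtain ⟨⟨u, hu, hdet⟩, c, hcd⟩ := hγ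
  rw [Matrix.det_fin_two, hcd] at hdet
  intro h
  apply hu
  simpa [mul_coeff_zero, h] using (congrArg (coeff · 0) hdet).symm

theorem exists_eq_mat_or_neg {γ : Matrix (Fin 2) (Fin 2) (ZMod 3)[X]} (hγ : γ ∈ Gamma0TTT)
    {k l : ℕ} (hkl : k + l ≤ 5)
    (hc : (γ 1 0).natDegree ≤ k + 2) (hd : (X ^ 2 * γ 1 1).natDegree ≤ k + 2)
    (hm : (mulAlpha (cuspRow γ) 0).natDegree ≤ l + 2)
    (hn : (X ^ 2 * mulAlpha (cuspRow γ) 1).natDegree ≤ l + 2) :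
    ∃ g ∈ codes, γ = g.mat ∨ γ = -g.mat := by
  rcases eq_one_or_eq_two (coeff_zero_ne_zero hγ) with h | h
  · obtain ⟨g, hg, h⟩ := exists_eq_mat hγ h hkl hc hd hm hn
    exact ⟨g, hg, Or.inl h⟩
  · have hneg (j : Fin 2) : mulAlpha (cuspRow (-γ)) j = -mulAlpha (cuspRow γ) j := by
      simp [mulAlpha, cuspRow]; ring
    obtain ⟨g, hg, h⟩ := exists_eq_mat (neg_mem_Gamma0TTT hγ)
      (by simp only [Matrix.neg_apply, coeff_neg, h]; rfl) hkl
      (by simpa using hc) (by simpa using hd) (by simpa [hneg] using hm) (by simpa [hneg] using hn)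
    exact ⟨g, hg, Or.inr (by rw [← h, neg_neg])⟩

theorem norm_prod_sub_one_le {K ι : Type*} [NormedField K] [IsUltrametricDist K] {f : ι → K}
    {r : ℝ} (hr0 : 0 ≤ r) (hr1 : r ≤ 1) (s : Finset ι) (h : ∀ i ∈ s, ‖f i - 1‖ ≤ r) :
    ‖∏ i ∈ s, f i - 1‖ ≤ r := by
  induction s using Finset.induction_on with
  | empty => simpa
  | insert i s hi ih =>
    have h1 := h i (Finset.mem_insert_self i s)
    have h2 := ih fun j hj => h j (Finset.mem_insert_of_mem hj)
    have h3 : ‖f i‖ ≤ 1 := by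
      rw [← sub_add_cancel (f i) 1]
      exact (IsUltrametricDist.norm_add_le_max _ _).trans (by simp [h1.trans hr1])
    rw [Finset.prod_insert hi, show f i * ∏ j ∈ s, f j - 1 =
      f i * (∏ j ∈ s, f j - 1) + (f i - 1) by ring]
    refine (IsUltrametricDist.norm_add_le_max _ _).trans (max_le ?_ h1)
    rw [norm_mul]
    exact (mul_le_of_le_one_left (norm_nonneg _) h3).trans h2

theorem norm_prod_sub_prod_le {K ι : Type*} [NormedField K] [IsUltrametricDist K] {f : ι → K}
    {r : ℝ} (hr0 : 0 ≤ r) (hr1 : r ≤ 1) {s t : Finset ι} (hst : s ⊆ t)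
    (h : ∀ i ∉ s, ‖f i - 1‖ ≤ r) : ‖∏ i ∈ t, f i - ∏ i ∈ s, f i‖ ≤ ‖∏ i ∈ s, f i‖ * r := by
  rw [← Finset.prod_sdiff hst, ← sub_one_mul, norm_mul, mul_comm]
  gcongr
  exact norm_prod_sub_one_le hr0 hr1 _ fun i hi => h i (Finset.mem_sdiff.1 hi).2

/-- In a complete nonarchimedean field, a family tending to 1 is multipliable. -/
theorem multipliable_of_finite_norm_sub_one {K ι : Type*} [NormedField K] [IsUltrametricDist K]
    [CompleteSpace K] {f : ι → K} (h : ∀ ε > 0, {i | ε < ‖f i - 1‖}.Finite) :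
    Multipliable f := by
  suffices CauchySeq fun s : Finset ι => ∏ i ∈ s, f i by
    obtain ⟨a, ha⟩ := cauchySeq_tendsto_of_complete this
    exact ⟨a, by simpa [HasProd] using ha⟩
  set S := (h 1 one_pos).toFinset with hS
  have hS1 (i) (hi : i ∉ S) : ‖f i - 1‖ ≤ 1 := by simpa [hS] using hi
  set B := 2 * ‖∏ i ∈ S, f i‖ + 1 with hB
  have hBpos : 0 < B := by positivity
  refine Metric.cauchySeq_iff'.2 fun ε hε => ?_
  set δ := min 1 (ε / (2 * B)) with hδ
  have hδpos : 0 < δ := by positivity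
  refine ⟨S ∪ (h δ hδpos).toFinset, fun t ht => ?_⟩
  have hbound : ‖∏ i ∈ S ∪ (h δ hδpos).toFinset, f i‖ ≤ B := by
    have := norm_prod_sub_prod_le zero_le_one le_rfl
      (Finset.subset_union_left (s₁ := S) (s₂ := (h δ hδpos).toFinset)) hS1
    linarith [norm_le_norm_add_norm_sub' (∏ i ∈ S ∪ (h δ hδpos).toFinset, f i) (∏ i ∈ S, f i)]
  rw [dist_eq_norm]
  refine (norm_prod_sub_prod_le hδpos.le (min_le_left _ _) ht fun i hi => ?_).trans_lt ?_
  · have := Finset.notMem_mono Finset.subset_union_right hi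
    simpa using this
  · calc _ ≤ B * (ε / (2 * B)) := by gcongr; exact min_le_right _ _
      _ = ε / 2 := by field_simp
      _ < ε := by linarith

theorem norm_tprod_sub_prod_le {K ι : Type*} [NormedField K] [IsUltrametricDist K] {f : ι → K}
    (hf : Multipliable f) {r : ℝ} (hr0 : 0 ≤ r) (hr1 : r ≤ 1) {s : Finset ι}
    (h : ∀ i ∉ s, ‖f i - 1‖ ≤ r) : ‖∏' i, f i - ∏ i ∈ s, f i‖ ≤ ‖∏ i ∈ s, f i‖ * r := by
  have h1 : Filter.Tendsto (fun t : Finset ι => ∏ i ∈ t, f i) Filter.atTop (nhds (∏' i, f i)) := by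
    simpa [HasProd] using hf.hasProd
  refine le_of_tendsto (h1.sub_const _).norm ?_
  filter_upwards [Filter.eventually_ge_atTop s] with t ht
  exact norm_prod_sub_prod_le hr0 hr1 ht h

section PolynomialNorm

variable {K : Type*} [NormedField K] {φ : (ZMod 3)[X] →+* K}

theorem norm_map_C {u : ZMod 3} (hu : u ≠ 0) : ‖φ (C u)‖ = 1 := by
  rcases eq_one_or_eq_two hu with rfl | rfl
  · simp
  · simp [C_two_eq_neg_one]

theorem norm_map_C_le (u : ZMod 3) : ‖φ (C u)‖ ≤ 1 := by
  by_cases hu : u = 0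
  · simp [hu]
  · exact (norm_map_C hu).le

theorem norm_eq_one_of_sq_add_one {ρ : K} (hρ : ρ ^ 2 + 1 = 0) : ‖ρ‖ = 1 := by
  have : ‖ρ‖ ^ 2 = 1 := by rw [← norm_pow, eq_neg_of_add_eq_zero_left hρ, norm_neg, norm_one]
  exact (pow_eq_one_iff_of_nonneg (norm_nonneg _) two_ne_zero).1 this

variable [IsUltrametricDist K]

theorem norm_map_of_ne_zero (hφ : ‖φ X‖ = 3) {p : (ZMod 3)[X]} (hp : p ≠ 0) :
    ‖φ p‖ = 3 ^ p.natDegree := by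
  induction hn : p.natDegree generalizing p with
  | zero =>
    rw [eq_C_of_natDegree_eq_zero hn] at hp ⊢
    simpa using norm_map_C (φ := φ) (u := p.coeff 0) (by rintro h; simp [h] at hp)
  | succ n ih =>
    have h1 : p.divX.natDegree = n := by rw [natDegree_divX_eq_natDegree_tsub_one, hn]; rfl
    have h2 : ‖φ (p.divX * X)‖ = 3 ^ (n + 1) := by
      rw [map_mul, norm_mul, hφ, ih _ h1, pow_succ]
      rintro h
      rw [divX_eq_zero_iff.1 h, natDegree_C] at hn
      omega
    have h3 : ‖φ (C (p.coeff 0))‖ < ‖φ (p.divX * X)‖ := by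
      rw [h2]
      exact (norm_map_C_le _).trans_lt (one_lt_pow₀ (by norm_num) (by omega))
    rw [← divX_mul_X_add p, map_add, IsUltrametricDist.norm_add_eq_max_of_norm_ne_norm h3.ne',
      max_eq_left h3.le, h2]

theorem norm_map_le (hφ : ‖φ X‖ = 3) {p : (ZMod 3)[X]} {n : ℕ} (hp : p.natDegree ≤ n) :
    ‖φ p‖ ≤ 3 ^ n := by
  by_cases h : p = 0
  · simp [h]
  · rw [norm_map_of_ne_zero hφ h]
    exact pow_le_pow_right₀ (by norm_num) hp

theorem norm_map_mul_add_map_le (hφ : ‖φ X‖ = 3) {ρ : K} (hρ : ‖ρ‖ = 1) {x y : (ZMod 3)[X]}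
    {n : ℕ} (hx : x.natDegree ≤ n) (hy : y.natDegree ≤ n) : ‖φ x * ρ + φ y‖ ≤ 3 ^ n := by
  refine (IsUltrametricDist.norm_add_le_max _ _).trans (max_le ?_ (norm_map_le hφ hy))
  rw [norm_mul, hρ, mul_one]
  exact norm_map_le hφ hx

theorem coeff_sq_add_sq_ne_zero {x y : (ZMod 3)[X]} (hxy : x ≠ 0 ∨ y ≠ 0) :
    (x ^ 2 + y ^ 2).coeff (2 * max x.natDegree y.natDegree) ≠ 0 := by
  have key : ∀ a b : ZMod 3, a * a + b * b = 0 → a = 0 ∧ b = 0 := by decide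
  set n := max x.natDegree y.natDegree with hn
  have hx : x.natDegree ≤ n := le_max_left _ _
  have hy : y.natDegree ≤ n := le_max_right _ _
  rw [coeff_add, two_mul, sq, sq, coeff_mul_add_eq_of_natDegree_le hx hx,
    coeff_mul_add_eq_of_natDegree_le hy hy]
  intro h
  obtain ⟨h1, h2⟩ := key _ _ h
  rcases max_choice x.natDegree y.natDegree with h3 | h3 <;> rw [← hn] at h3
  · rw [h3, coeff_natDegree, leadingCoeff_eq_zero] at h1
    rw [h1, natDegree_zero] at h3
    rw [show n = y.natDegree by omega, coeff_natDegree, leadingCoeff_eq_zero] at h2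
    exact hxy.elim (· h1) (· h2)
  · rw [h3, coeff_natDegree, leadingCoeff_eq_zero] at h2
    rw [h2, natDegree_zero] at h3
    rw [show n = x.natDegree by omega, coeff_natDegree, leadingCoeff_eq_zero] at h1
    exact hxy.elim (· h1) (· h2)

theorem natDegree_sq_add_sq {x y : (ZMod 3)[X]} (hxy : x ≠ 0 ∨ y ≠ 0) :
    (x ^ 2 + y ^ 2).natDegree = 2 * max x.natDegree y.natDegree := by
  refine natDegree_eq_of_le_of_coeff_ne_zero ?_ (coeff_sq_add_sq_ne_zero hxy)
  refine natDegree_add_le_of_degree_le ?_ ?_ <;> refine natDegree_pow_le.trans ?_ <;> gcongr <;>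
    simp

theorem norm_map_mul_add_map (hφ : ‖φ X‖ = 3) {ρ : K} (hρ : ρ ^ 2 + 1 = 0) {x y : (ZMod 3)[X]}
    (hxy : x ≠ 0 ∨ y ≠ 0) : ‖φ x * ρ + φ y‖ = 3 ^ max x.natDegree y.natDegree := by
  have hρ1 := norm_eq_one_of_sq_add_one hρ
  have h1 : ‖φ x * ρ + φ y‖ ≤ 3 ^ max x.natDegree y.natDegree :=
    norm_map_mul_add_map_le hφ hρ1 (le_max_left _ _) (le_max_right _ _)
  have h2 : ‖φ (-x) * ρ + φ y‖ ≤ 3 ^ max x.natDegree y.natDegree :=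
    norm_map_mul_add_map_le hφ hρ1 (by simp) (le_max_right _ _)
  have h0 : x ^ 2 + y ^ 2 ≠ 0 := fun h => coeff_sq_add_sq_ne_zero hxy (by simp [h])
  have h3 : ‖φ x * ρ + φ y‖ * ‖φ (-x) * ρ + φ y‖ =
      3 ^ max x.natDegree y.natDegree * 3 ^ max x.natDegree y.natDegree := by
    rw [← norm_mul, ← pow_add, ← two_mul, ← natDegree_sq_add_sq hxy,
      ← norm_map_of_ne_zero hφ h0]
    congr 1
    simp only [map_neg, map_add, map_pow]
    linear_combination -(φ x) ^ 2 * hρ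
  refine le_antisymm h1 ?_
  have : (0 : ℝ) < 3 ^ max x.natDegree y.natDegree := by positivity
  nlinarith [norm_nonneg (φ x * ρ + φ y)]

end PolynomialNorm

theorem finite_natDegree_le (n : ℕ) : {p : (ZMod 3)[X] | p.natDegree ≤ n}.Finite := by
  have : Finite (degreeLT (ZMod 3) (n + 1)) :=
    Finite.of_injective _ (degreeLTEquiv (ZMod 3) (n + 1)).injective
  refine (Set.toFinite (degreeLT (ZMod 3) (n + 1) : Set (ZMod 3)[X])).subset fun p hp => ?_
  rw [SetLike.mem_coe, mem_degreeLT]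
  exact (degree_le_of_natDegree_le hp).trans_lt (by exact_mod_cast n.lt_succ_self)

theorem mulAlpha_injective : Function.Injective mulAlpha := by
  intro v w h
  have h0 := congrFun h 0
  have h1 := congrFun h 1
  simp only [mulAlpha_zero, mulAlpha_one] at h0 h1
  funext j
  fin_cases j
  · simp only [Fin.zero_eta]
    linear_combination (X ^ 4 + X ^ 3 + X ^ 2) * h1 - (2 * X ^ 2 + 2 * X + 1) * h0 +
      (v 0 - w 0) * det_alpha3
  · simp only [Fin.mk_one]
    linear_combination (2 * X + 1) * h0 - (X ^ 3 + 2 * X ^ 2 + 2 * X + 2) * h1 +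
      (v 1 - w 1) * det_alpha3

theorem mulAlpha_ne_zero {v : Fin 2 → (ZMod 3)[X]} (hv : v ≠ 0) : mulAlpha v ≠ 0 := by
  have h : mulAlpha 0 = 0 := by funext j; simp [mulAlpha]
  exact fun h' => hv (mulAlpha_injective (h'.trans h.symm))

theorem row_ne_zero {γ : Matrix (Fin 2) (Fin 2) (ZMod 3)[X]} (hγ : γ ∈ Gamma0TTT) : γ 1 ≠ 0 := by
  intro h
  simpa [h] using coeff_zero_ne_zero hγ

theorem cuspRow_ne_zero {γ : Matrix (Fin 2) (Fin 2) (ZMod 3)[X]} (hγ : γ ∈ Gamma0TTT) :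
    cuspRow γ ≠ 0 := by
  obtain ⟨⟨u, hu, hdet⟩, -⟩ := hγ
  intro h
  have h0 := congrFun h 0
  have h1 := congrFun h 1
  simp only [cuspRow, Pi.zero_apply] at h0 h1
  rw [Matrix.det_fin_two] at hdet
  exact hu (C_eq_zero.1 (by linear_combination γ 0 0 * h1 - γ 0 1 * h0 - hdet))

/-- The exponent of the norm of `T² (v₀ ω + v₁)`. -/
noncomputable def size (v : Fin 2 → (ZMod 3)[X]) : ℕ :=
  max (v 0).natDegree (X ^ 2 * v 1).natDegree

theorem natDegree_le_size (v : Fin 2 → (ZMod 3)[X]) (j : Fin 2) : (v j).natDegree ≤ size v := by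
  fin_cases j
  · exact le_max_left _ _
  · by_cases h : v 1 = 0
    · simp [h]
    · refine le_trans ?_ (le_max_right _ _)
      rw [natDegree_mul (pow_ne_zero _ X_ne_zero) h]
      exact Nat.le_add_left _ _

theorem finite_size_le (n : ℕ) : {γ : Matrix (Fin 2) (Fin 2) (ZMod 3)[X] |
    size (γ 1) + size (mulAlpha (cuspRow γ)) ≤ n}.Finite := by
  have h : {v : Fin 2 → (ZMod 3)[X] | ∀ j, v j ∈ {p : (ZMod 3)[X] | p.natDegree ≤ n}}.Finite :=
    Set.Finite.pi' fun _ => finite_natDegree_le n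
  refine Set.Finite.of_injOn (f := fun γ => (γ 1, mulAlpha (cuspRow γ))) ?_ ?_ (h.prod h)
  · rintro γ hγ
    exact ⟨fun j => (natDegree_le_size _ j).trans ((Nat.le_add_right _ _).trans hγ),
      fun j => (natDegree_le_size _ j).trans ((Nat.le_add_left _ _).trans hγ)⟩
  · rintro γ - δ - h
    obtain ⟨h1, h2⟩ := Prod.mk.inj h
    ext1 i j
    have h3 := congrFun h1 j
    fin_cases i
    · have h4 := congrFun (mulAlpha_injective h2) j
      refine mul_left_cancel₀ X_sq_sub_X_ne_zero ?_
      simp only [cuspRow] at h4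
      simp only [Fin.zero_eta]
      linear_combination h3 - h4
    · exact h3

theorem two_le_size_row {γ : Matrix (Fin 2) (Fin 2) (ZMod 3)[X]} (hγ : γ ∈ Gamma0TTT) :
    2 ≤ size (γ 1) := by
  refine le_trans ?_ (le_max_right _ _)
  rw [natDegree_mul (pow_ne_zero _ X_ne_zero), natDegree_X_pow]
  · omega
  · intro h
    simpa [h] using coeff_zero_ne_zero hγ

theorem two_le_size_mulAlpha {γ : Matrix (Fin 2) (Fin 2) (ZMod 3)[X]} (hγ : γ ∈ Gamma0TTT) :
    2 ≤ size (mulAlpha (cuspRow γ)) := by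
  by_cases h1 : mulAlpha (cuspRow γ) 1 = 0
  · have h0 : mulAlpha (cuspRow γ) 0 ≠ 0 := by
      intro h0
      apply mulAlpha_ne_zero (cuspRow_ne_zero hγ)
      funext j
      fin_cases j <;> assumption
    obtain ⟨-, c, hc⟩ := hγ
    have h2 : mulAlpha (cuspRow γ) 0 = (X ^ 2 - X) * ((X * c - γ 0 0) *
        (X ^ 3 + 2 * X ^ 2 + 2 * X + 2) + (γ 1 1 - (X ^ 2 - X) * γ 0 1) * (X ^ 2 - X)) := by
      rw [mulAlpha_zero, cuspRow, cuspRow, hc]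
      linear_combination (γ 1 1 - (X ^ 2 - X) * γ 0 1) * X ^ 3 * three_eq_zero
    refine le_trans ?_ (le_max_left _ _)
    rw [h2] at h0 ⊢
    rw [natDegree_mul X_sq_sub_X_ne_zero (right_ne_zero_of_mul h0), natDegree_X_sq_sub_X]
    omega
  · refine le_trans ?_ (le_max_right _ _)
    rw [natDegree_mul (pow_ne_zero _ X_ne_zero) h1, natDegree_X_pow]
    omega

theorem exists_eq_mat_or_neg_of_size_le {γ : Matrix (Fin 2) (Fin 2) (ZMod 3)[X]}
    (hγ : γ ∈ Gamma0TTT) (h : size (γ 1) + size (mulAlpha (cuspRow γ)) ≤ 9) :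
    ∃ g ∈ codes, γ = g.mat ∨ γ = -g.mat := by
  obtain ⟨k, hk⟩ := Nat.exists_eq_add_of_le' (two_le_size_row hγ)
  obtain ⟨l, hl⟩ := Nat.exists_eq_add_of_le' (two_le_size_mulAlpha hγ)
  exact exists_eq_mat_or_neg hγ (k := k) (l := l) (by omega) (hk ▸ le_max_left _ _)
    (hk ▸ le_max_right _ _) (hl ▸ le_max_left _ _) (hl ▸ le_max_right _ _)

section Terms

variable {K : Type*} [NormedField K] {φ : (ZMod 3)[X] →+* K} {ρ : K}

/-- The element `T² (v₀ ω + v₁)`, where `ω = ρ / T²`. -/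
noncomputable def linForm (φ : (ZMod 3)[X] →+* K) (ρ : K) (v : Fin 2 → (ZMod 3)[X]) : K :=
  φ (v 0) * ρ + φ (X ^ 2 * v 1)

theorem linForm_cuspRow_mul_sub (hρ : ρ ^ 2 + 1 = 0) (γ : Matrix (Fin 2) (Fin 2) (ZMod 3)[X]) :
    linForm φ ρ (cuspRow γ) * linForm φ ρ (mulAlpha (γ 1)) -
      linForm φ ρ (γ 1) * linForm φ ρ (mulAlpha (cuspRow γ)) =
    φ ((X ^ 2 - X) * γ.det) * (φ (X ^ 2 * (alpha3 0 0 - alpha3 1 1)) * ρ +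
      φ (alpha3 1 0 + X ^ 4 * alpha3 0 1)) := by
  simp only [linForm, mulAlpha, cuspRow, Matrix.det_fin_two, map_mul, map_add, map_sub, map_pow]
  linear_combination (-φ (alpha3 1 0)) * (φ X ^ 2 - φ X) *
    (φ (γ 0 0) * φ (γ 1 1) - φ (γ 0 1) * φ (γ 1 0)) * hρ

variable [IsUltrametricDist K]

theorem norm_linForm (hφ : ‖φ X‖ = 3) (hρ : ρ ^ 2 + 1 = 0) {v : Fin 2 → (ZMod 3)[X]}
    (hv : v ≠ 0) : ‖linForm φ ρ v‖ = 3 ^ size v := by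
  refine norm_map_mul_add_map hφ hρ ?_
  by_contra! h
  apply hv
  funext j
  fin_cases j
  · exact h.1
  · exact (mul_eq_zero.1 h.2).resolve_left (pow_ne_zero _ X_ne_zero)

theorem linForm_ne_zero (hφ : ‖φ X‖ = 3) (hρ : ρ ^ 2 + 1 = 0) {v : Fin 2 → (ZMod 3)[X]}
    (hv : v ≠ 0) : linForm φ ρ v ≠ 0 := by
  rw [← norm_ne_zero_iff, norm_linForm hφ hρ hv]
  positivity

/-- The factor `(s - γ ω) / (s - γ α ω)` of the product, for `s = 1 / (T² - T)`. -/
noncomputable def cuspFactor (φ : (ZMod 3)[X] →+* K) (ρ : K)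
    (γ : Matrix (Fin 2) (Fin 2) (ZMod 3)[X]) : K :=
  linForm φ ρ (cuspRow γ) * linForm φ ρ (mulAlpha (γ 1)) /
    (linForm φ ρ (γ 1) * linForm φ ρ (mulAlpha (cuspRow γ)))

theorem norm_cuspFactor_sub_one_le (hφ : ‖φ X‖ = 3) (hρ : ρ ^ 2 + 1 = 0)
    {γ : Matrix (Fin 2) (Fin 2) (ZMod 3)[X]} (hγ : γ ∈ Gamma0TTT) :
    ‖cuspFactor φ ρ γ - 1‖ ≤ 3 ^ 7 / 3 ^ (size (γ 1) + size (mulAlpha (cuspRow γ))) := by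
  have h1 := linForm_ne_zero hφ hρ (row_ne_zero hγ)
  have h2 := linForm_ne_zero hφ hρ (mulAlpha_ne_zero (cuspRow_ne_zero hγ))
  rw [cuspFactor, div_sub_one (mul_ne_zero h1 h2), linForm_cuspRow_mul_sub hρ, norm_div, norm_mul,
    norm_mul, norm_linForm hφ hρ (row_ne_zero hγ),
    norm_linForm hφ hρ (mulAlpha_ne_zero (cuspRow_ne_zero hγ)), ← pow_add]
  gcongr
  obtain ⟨⟨u, hu, hdet⟩, -⟩ := hγ
  rw [hdet, map_mul, norm_mul, norm_map_C hu, mul_one, norm_map_of_ne_zero hφ X_sq_sub_X_ne_zero,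
    natDegree_X_sq_sub_X, show 7 = 2 + 5 from rfl, pow_add]
  gcongr
  refine norm_map_mul_add_map_le hφ (norm_eq_one_of_sq_add_one hρ) ?_ ?_
  · simp only [alpha3, Matrix.of_apply, Matrix.cons_val', Matrix.cons_val_zero, Matrix.cons_val_one,
      Matrix.cons_val_fin_one]
    compute_degree
  · simp only [alpha3, Matrix.of_apply, Matrix.cons_val', Matrix.cons_val_zero, Matrix.cons_val_one,
      Matrix.cons_val_fin_one]
    compute_degree

end Terms

/-- The coefficient list `l` without its trailing zeros modulo 3. -/
def trimL : List ℕ → List ℕ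
  | [] => []
  | x :: l =>
    match trimL l with
    | [] => if x % 3 == 0 then [] else [x]
    | y :: l' => x :: y :: l'

/-- `(n, x, y)` stands for `T ^ n (x ρ + y)` up to lower order terms. -/
abbrev Approx := ℕ × List ℕ × List ℕ

def Approx.mul (s s' : Approx) : Approx :=
  (s.1 + s'.1 + 2, (addL (mulL s.2.1 s'.2.2) (mulL s'.2.1 s.2.2)).drop 2,
    (subL (mulL s.2.2 s'.2.2) (mulL s.2.1 s'.2.1)).drop 2)

def Approx.ofLists (x y : List ℕ) : Approx :=
  let x' := trimL x
  let y' := trimL y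
  let n := max x'.length y'.length - 3
  (n, x'.drop n, y'.drop n)

def rowL (g : Code) : List ℕ × List ℕ := (mulL [0, 0, 2, 1] g.c, g.d)

def cuspRowL (g : Code) : List ℕ × List ℕ :=
  (subL (mulL [0, 0, 2, 1] g.c) (mulL [0, 2, 1] g.a), subL g.d (mulL [0, 2, 1] g.b))

def mulAlphaL (v : List ℕ × List ℕ) : List ℕ × List ℕ :=
  (addL (mulL v.1 [2, 2, 2, 1]) (mulL v.2 [0, 0, 1, 1, 1]),
    addL (mulL v.1 [1, 2]) (mulL v.2 [1, 2, 2]))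

def linFormL (v : List ℕ × List ℕ) : Approx := Approx.ofLists v.1 (0 :: 0 :: v.2)

def numL (l : List Code) : Approx :=
  l.foldr (fun g s => ((linFormL (cuspRowL g)).mul (linFormL (mulAlphaL (rowL g)))).mul s)
    (0, [], [0, 0, 1])

def denL (l : List Code) : Approx :=
  l.foldr (fun g s => ((linFormL (rowL g)).mul (linFormL (mulAlphaL (cuspRowL g)))).mul s)
    (0, [], [0, 0, 1])

theorem numL_codes : numL codes = (521, [2, 2, 2], [2, 0, 0]) := by decide +kernel

theorem denL_codes : denL codes = (524, [2, 2, 2], [2, 0, 0]) := by decide +kernel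

/-- Whether the determinant is a unit and the lower right entry has constant coefficient 1. -/
def isNormalized (g : Code) : Bool :=
  (eqL (subL (mulL g.a g.d) (mulL g.b (mulL [0, 0, 2, 1] g.c))) [1] ||
    eqL (subL (mulL g.a g.d) (mulL g.b (mulL [0, 0, 2, 1] g.c))) [2]) && g.d.headD 0 == 1

def isDistinct (g h : Code) : Bool := !(eqL g.a h.a && eqL g.b h.b && eqL g.c h.c && eqL g.d h.d)

theorem isNormalized_codes : codes.all isNormalized = true := by decide +kernel

theorem pairwise_isDistinct_codes : codes.Pairwise fun g h => isDistinct g h = true := by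
  decide +kernel

theorem ofL_X_cube_sub_X_sq : ofL [0, 0, 2, 1] = X ^ 3 - X ^ 2 := by
  simp only [ofL]
  push_cast
  rw [C_two_eq_neg_one, C_0, C_1]
  ring

theorem ofL_X_sq_sub_X : ofL [0, 2, 1] = X ^ 2 - X := by
  simp only [ofL]
  push_cast
  rw [C_two_eq_neg_one, C_0, C_1]
  ring

theorem ofL_trimL (l : List ℕ) : ofL (trimL l) = ofL l := by
  induction l with
  | nil => rfl
  | cons x l ih =>
    rw [trimL]
    split
    next h =>
      rw [h] at ih
      split_ifs with hx
      · have hx : ((x : ℕ) : ZMod 3) = 0 := by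
          rw [ZMod.natCast_eq_zero_iff]
          exact Nat.dvd_of_mod_eq_zero (by simpa using hx)
        simp only [ofL] at ih ⊢
        rw [← ih, hx]
        simp
      · simp only [ofL] at ih ⊢
        rw [ih]
    next y l' h =>
      rw [h] at ih
      rw [ofL, ih, ofL]

theorem ofL_take_add_drop (k : ℕ) (l : List ℕ) :
    ofL (l.take k) + X ^ k * ofL (l.drop k) = ofL l := by
  induction k generalizing l with
  | zero => simp [ofL]
  | succ k ih =>
    cases l with
    | nil => simp [ofL]
    | cons x l =>
      simp only [List.take_succ_cons, List.drop_succ_cons, ofL]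
      rw [← ih l]
      ring

theorem length_addL (a b : List ℕ) : (addL a b).length = max a.length b.length := by
  induction a generalizing b with
  | nil => simp [addL]
  | cons x a ih =>
    cases b with
    | nil => simp [addL]
    | cons y b => simp [addL, ih]

theorem length_smulL (r : ℕ) (a : List ℕ) : (smulL r a).length = a.length := by
  induction a with
  | nil => rfl
  | cons x a ih => simp [smulL, ih]

theorem length_mulL_le {a b : List ℕ} {m n : ℕ} (ha : a.length ≤ m) (hb : b.length ≤ n + 1) :
    (mulL a b).length ≤ m + n := by
  induction a generalizing m with
  | nil => simp [mulL]
  | cons x a ih =>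
    rw [List.length_cons] at ha
    have := ih (m := m - 1) (by omega)
    rw [mulL, length_addL, length_smulL, List.length_cons]
    omega

section Approximation

variable {K : Type*} [NormedField K] {φ : (ZMod 3)[X] →+* K} {ρ : K}

/-- The element `x ρ + y`, where `x` and `y` are given by coefficient lists. -/
noncomputable def listForm (φ : (ZMod 3)[X] →+* K) (ρ : K) (x y : List ℕ) : K :=
  φ (ofL x) * ρ + φ (ofL y)

theorem listForm_sub_drop (k : ℕ) (x y : List ℕ) :
    listForm φ ρ x y - φ X ^ k * listForm φ ρ (x.drop k) (y.drop k) =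
      listForm φ ρ (x.take k) (y.take k) := by
  have hx := congrArg φ (ofL_take_add_drop k x)
  have hy := congrArg φ (ofL_take_add_drop k y)
  simp only [map_add, map_mul, map_pow] at hx hy
  simp only [listForm]
  linear_combination -ρ * hx - hy

theorem listForm_mul (hρ : ρ ^ 2 + 1 = 0) (x y x' y' : List ℕ) :
    listForm φ ρ x y * listForm φ ρ x' y' =
      listForm φ ρ (addL (mulL x y') (mulL x' y)) (subL (mulL y y') (mulL x x')) := by
  simp only [listForm, ofL_addL, ofL_subL, ofL_mulL, map_add, map_sub, map_mul]
  linear_combination φ (ofL x) * φ (ofL x') * hρ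

theorem linForm_eq_listForm {v : Fin 2 → (ZMod 3)[X]} {w : List ℕ × List ℕ}
    (h0 : v 0 = ofL w.1) (h1 : v 1 = ofL w.2) :
    linForm φ ρ v = listForm φ ρ w.1 (0 :: 0 :: w.2) := by
  simp only [linForm, listForm, ofL, h0, h1, Nat.cast_zero, C_0, zero_add, sq, mul_assoc]

variable [IsUltrametricDist K]

theorem norm_map_ofL_le (hφ : ‖φ X‖ = 3) {l : List ℕ} {n : ℕ} (hl : l.length ≤ n) :
    3 * ‖φ (ofL l)‖ ≤ 3 ^ n := by
  induction l generalizing n with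
  | nil => simp [ofL]
  | cons x l ih =>
    obtain ⟨n, rfl⟩ : ∃ m, n = m + 1 := ⟨n - 1, by rw [List.length_cons] at hl; omega⟩
    rw [ofL, map_add, map_mul, pow_succ']
    gcongr
    refine (IsUltrametricDist.norm_add_le_max _ _).trans (max_le ?_ ?_)
    · exact (norm_map_C_le _).trans (one_le_pow₀ (by norm_num))
    · rw [norm_mul, hφ]
      exact ih (by simpa using hl)

theorem norm_listForm_le (hφ : ‖φ X‖ = 3) (hρ : ‖ρ‖ = 1) {x y : List ℕ} {n : ℕ}
    (hx : x.length ≤ n) (hy : y.length ≤ n) : 3 * ‖listForm φ ρ x y‖ ≤ 3 ^ n := by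
  have h := IsUltrametricDist.norm_add_le_max (φ (ofL x) * ρ) (φ (ofL y))
  rw [norm_mul, hρ, mul_one] at h
  have h1 := norm_map_ofL_le hφ hx
  have h2 := norm_map_ofL_le hφ hy
  rcases le_max_iff.1 h with h | h <;> rw [listForm] <;> linarith

/-- The element `z` is `T ^ n (x ρ + y)` up to terms of relative size `3⁻³`. -/
def IsApprox (φ : (ZMod 3)[X] →+* K) (ρ : K) (z : K) (s : Approx) : Prop :=
  3 * ‖z - φ X ^ s.1 * listForm φ ρ s.2.1 s.2.2‖ ≤ 3 ^ s.1 ∧ s.2.1.length ≤ 3 ∧ s.2.2.length ≤ 3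

theorem isApprox_ofLists (hφ : ‖φ X‖ = 3) (hρ : ‖ρ‖ = 1) (x y : List ℕ) :
    IsApprox φ ρ (listForm φ ρ x y) (Approx.ofLists x y) := by
  rw [listForm, ← ofL_trimL x, ← ofL_trimL y, ← listForm]
  refine ⟨?_, ?_, ?_⟩
  · simp only [Approx.ofLists]
    rw [listForm_sub_drop]
    exact norm_listForm_le hφ hρ (List.length_take_le _ _) (List.length_take_le _ _)
  · simp only [Approx.ofLists, List.length_drop]
    omega
  · simp only [Approx.ofLists, List.length_drop]
    omega

theorem IsApprox.norm_le (hφ : ‖φ X‖ = 3) (hρ : ‖ρ‖ = 1) {z : K} {s : Approx}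
    (h : IsApprox φ ρ z s) : ‖z‖ ≤ 3 ^ (s.1 + 2) := by
  obtain ⟨h1, h2, h3⟩ := h
  have h4 := norm_listForm_le hφ hρ h2 h3
  have h5 : (0 : ℝ) < 3 ^ s.1 := by positivity
  rw [← sub_add_cancel z (φ X ^ s.1 * listForm φ ρ s.2.1 s.2.2), pow_add]
  refine (IsUltrametricDist.norm_add_le_max _ _).trans (max_le (by linarith) ?_)
  rw [norm_mul, norm_pow, hφ]
  gcongr
  linarith

theorem IsApprox.mul (hφ : ‖φ X‖ = 3) (hρ : ρ ^ 2 + 1 = 0) {z z' : K} {s s' : Approx}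
    (h : IsApprox φ ρ z s) (h' : IsApprox φ ρ z' s') : IsApprox φ ρ (z * z') (s.mul s') := by
  have hρ1 := norm_eq_one_of_sq_add_one hρ
  have hz' := h'.norm_le hφ hρ1
  obtain ⟨n, x, y⟩ := s
  obtain ⟨n', x', y'⟩ := s'
  obtain ⟨h1, h2, h3⟩ := h
  obtain ⟨h1', h2', h3'⟩ := h'
  refine ⟨?_, ?_, ?_⟩
  · simp only [Approx.mul] at h1 h1' h2 h3 hz' ⊢
    have h4 := norm_listForm_le hφ hρ1 h2 h3
    set w := listForm φ ρ x y with hw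
    set w' := listForm φ ρ x' y' with hw'
    have h5 := listForm_sub_drop (φ := φ) (ρ := ρ) 2 (addL (mulL x y') (mulL x' y))
      (subL (mulL y y') (mulL x x'))
    rw [← listForm_mul hρ, ← hw, ← hw'] at h5
    set v := listForm φ ρ ((addL (mulL x y') (mulL x' y)).drop 2)
      ((subL (mulL y y') (mulL x x')).drop 2)
    have h6 : 3 * ‖w * w' - φ X ^ 2 * v‖ ≤ 3 ^ 2 := by
      rw [h5]
      exact norm_listForm_le hφ hρ1 (List.length_take_le _ _) (List.length_take_le _ _)
    rw [show z * z' - φ X ^ (n + n' + 2) * v = (z - φ X ^ n * w) * z' +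
      (φ X ^ n * w * (z' - φ X ^ n' * w') + φ X ^ (n + n') * (w * w' - φ X ^ 2 * v)) by ring]
    have hn : (0 : ℝ) < 3 ^ n := by positivity
    have hn' : (0 : ℝ) < 3 ^ n' := by positivity
    have key : ∀ a b c : K, ∀ r : ℝ, 3 * ‖a‖ ≤ r → 3 * ‖b‖ ≤ r → 3 * ‖c‖ ≤ r →
        3 * ‖a + (b + c)‖ ≤ r := by
      intro a b c r ha hb hc
      rcases le_max_iff.1 (IsUltrametricDist.norm_add_le_max a (b + c)) with h | h
      · linarith
      rcases le_max_iff.1 (IsUltrametricDist.norm_add_le_max b c) with h' | h' <;> linarith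
    apply key
    · rw [norm_mul, ← mul_assoc, show (3 : ℝ) ^ (n + n' + 2) = 3 ^ n * 3 ^ (n' + 2) by ring]
      gcongr
    · rw [norm_mul, norm_mul, norm_pow, hφ]
      calc 3 * (3 ^ n * ‖w‖ * ‖z' - φ X ^ n' * w'‖)
          = 3 ^ n * ‖w‖ * (3 * ‖z' - φ X ^ n' * w'‖) := by ring
        _ ≤ 3 ^ n * 3 ^ 2 * 3 ^ n' := by gcongr; linarith
        _ = 3 ^ (n + n' + 2) := by ring
    · rw [norm_mul, norm_pow, hφ]
      calc 3 * (3 ^ (n + n') * ‖w * w' - φ X ^ 2 * v‖)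
          = 3 ^ (n + n') * (3 * ‖w * w' - φ X ^ 2 * v‖) := by ring
        _ ≤ 3 ^ (n + n') * 3 ^ 2 := by gcongr
        _ = 3 ^ (n + n' + 2) := by ring
  · have := length_mulL_le h2 h3'
    have := length_mulL_le h2' h3
    simp only [Approx.mul, List.length_drop, length_addL] at *
    omega
  · have := length_mulL_le h3 h3'
    have := length_mulL_le h2 h2'
    simp only [Approx.mul, List.length_drop, length_addL, subL, length_smulL] at *
    omega

theorem isApprox_linForm (hφ : ‖φ X‖ = 3) (hρ : ρ ^ 2 + 1 = 0) {v : Fin 2 → (ZMod 3)[X]}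
    {w : List ℕ × List ℕ} (h : v = ![ofL w.1, ofL w.2]) :
    IsApprox φ ρ (linForm φ ρ v) (linFormL w) := by
  rw [linForm_eq_listForm (w := w) (by simp [h]) (by simp [h])]
  exact isApprox_ofLists hφ (norm_eq_one_of_sq_add_one hρ) _ _

end Approximation

theorem mat_one (g : Code) : g.mat 1 = ![ofL (rowL g).1, ofL (rowL g).2] := by
  funext j
  fin_cases j
  · simp [Code.mat, rowL, ofL_mulL, ofL_X_cube_sub_X_sq]
  · simp [Code.mat, rowL]

theorem cuspRow_mat (g : Code) : cuspRow g.mat = ![ofL (cuspRowL g).1, ofL (cuspRowL g).2] := by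
  funext j
  fin_cases j <;>
    simp [cuspRow, Code.mat, cuspRowL, ofL_mulL, ofL_subL, ofL_X_cube_sub_X_sq, ofL_X_sq_sub_X]

theorem mulAlpha_ofL (w : List ℕ × List ℕ) :
    mulAlpha ![ofL w.1, ofL w.2] = ![ofL (mulAlphaL w).1, ofL (mulAlphaL w).2] := by
  funext j
  fin_cases j
  · simp only [Fin.zero_eta, mulAlpha_zero]
    simp only [Matrix.cons_val_zero, Matrix.cons_val_one, mulAlphaL, ofL_addL, ofL_mulL, ofL]
    push_cast
    simp only [C_0, C_1, C_two_eq_neg_one, two_eq_neg_one]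
    ring
  · simp only [Fin.mk_one, mulAlpha_one]
    simp only [Matrix.cons_val_zero, Matrix.cons_val_one, mulAlphaL, ofL_addL, ofL_mulL, ofL]
    push_cast
    simp only [C_1, C_two_eq_neg_one, two_eq_neg_one]
    ring

theorem mat_mem_Gamma0TTT {g : Code} (hg : g ∈ codes) : g.mat ∈ Gamma0TTT := by
  have h := List.all_eq_true.1 isNormalized_codes g hg
  simp only [isNormalized, Bool.and_eq_true, Bool.or_eq_true, eqL_iff, ofL_subL, ofL_mulL,
    ofL_X_cube_sub_X_sq] at h
  have hdet : g.mat.det = ofL g.a * ofL g.d - ofL g.b * ((X ^ 3 - X ^ 2) * ofL g.c) := by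
    simp [Code.mat, Matrix.det_fin_two]
  refine ⟨?_, ofL g.c, by simp [Code.mat]⟩
  rw [hdet]
  rcases h.1 with h | h
  · exact ⟨1, by decide, by rw [h]; simp [ofL]⟩
  · exact ⟨2, by decide, by rw [h]; simp [ofL]⟩

theorem coeff_zero_d {g : Code} (hg : g ∈ codes) : (ofL g.d).coeff 0 = 1 := by
  have h := List.all_eq_true.1 isNormalized_codes g hg
  simp only [isNormalized, Bool.and_eq_true, beq_iff_eq] at h
  obtain ⟨-, h⟩ := h
  cases hd : g.d with
  | nil => simp [hd] at h
  | cons x l =>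
    rw [hd, List.headD_cons] at h
    simp [coeff_zero_ofL_cons, h]

theorem mat_ne_neg_mat {g h : Code} (hg : g ∈ codes) (hh : h ∈ codes) : g.mat ≠ -h.mat := by
  intro e
  have e1 : ofL g.d = -ofL h.d := by simpa [Code.mat] using congrFun (congrFun e 1) 1
  have e2 := congrArg (coeff · 0) e1
  simp only [coeff_neg, coeff_zero_d hg, coeff_zero_d hh] at e2
  exact absurd e2 (by decide)

theorem mat_ne_mat {g h : Code} (hgh : isDistinct g h = true) : g.mat ≠ h.mat := by
  intro e
  have e1 (i j) : g.mat i j = h.mat i j := by rw [e]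
  have hX : (X ^ 3 - X ^ 2 : (ZMod 3)[X]) ≠ 0 := by
    intro h; simpa [h] using natDegree_X_cube_sub_X_sq
  have ha := e1 0 0
  have hb := e1 0 1
  have hc := e1 1 0
  have hd := e1 1 1
  simp only [Code.mat, Matrix.of_apply, Matrix.cons_val', Matrix.cons_val_zero, Matrix.cons_val_one,
    Matrix.cons_val_fin_one] at ha hb hc hd
  have hc := mul_left_cancel₀ hX hc
  simp [isDistinct, (eqL_iff _ _).2 ha, (eqL_iff _ _).2 hb, (eqL_iff _ _).2 hc,
    (eqL_iff _ _).2 hd] at hgh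

/-- The classes in `Γ / {±1}` of the listed matrices. -/
noncomputable def classes : List (Quotient pmSetoid) :=
  codes.pmap (fun g h => Quotient.mk pmSetoid ⟨g.mat, h⟩) fun _ => mat_mem_Gamma0TTT

theorem nodup_classes : classes.Nodup := by
  refine (List.Pairwise.and_mem.1 pairwise_isDistinct_codes).pmap _ ?_
  rintro g _ h _ ⟨hg, hh, hgh⟩ e
  rcases Quotient.exact e with e | e
  · exact mat_ne_mat hgh e.symm
  · exact mat_ne_neg_mat hh hg e

theorem mk_mem_classes {γ : Gamma0TTT} (h : size (γ.1 1) + size (mulAlpha (cuspRow γ.1)) ≤ 9) :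
    Quotient.mk pmSetoid γ ∈ classes := by
  obtain ⟨g, hg, h⟩ := exists_eq_mat_or_neg_of_size_le γ.2 h
  refine List.mem_pmap.2 ⟨g, hg, Quotient.sound ?_⟩
  exact h

theorem isApprox_X_sq {K : Type*} [NormedField K] (φ : (ZMod 3)[X] →+* K) (ρ : K) :
    IsApprox φ ρ (φ X ^ 2) (0, [], [0, 0, 1]) := by
  simp [IsApprox, listForm, ofL, sq]

section Product

variable {K : Type*} [NormedField K] [IsUltrametricDist K] {φ : (ZMod 3)[X] →+* K} {ρ : K}

theorem isApprox_numL (hφ : ‖φ X‖ = 3) (hρ : ρ ^ 2 + 1 = 0) (l : List Code) :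
    IsApprox φ ρ ((l.map fun g => linForm φ ρ (cuspRow g.mat) *
      linForm φ ρ (mulAlpha (g.mat 1))).prod * φ X ^ 2) (numL l) := by
  induction l with
  | nil => simpa [numL] using isApprox_X_sq φ ρ
  | cons g l ih =>
    rw [List.map_cons, List.prod_cons, mul_assoc]
    refine IsApprox.mul hφ hρ (IsApprox.mul hφ hρ ?_ ?_) ih
    · exact isApprox_linForm hφ hρ (cuspRow_mat g)
    · exact isApprox_linForm hφ hρ (by rw [mat_one, mulAlpha_ofL])

theorem isApprox_denL (hφ : ‖φ X‖ = 3) (hρ : ρ ^ 2 + 1 = 0) (l : List Code) :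
    IsApprox φ ρ ((l.map fun g => linForm φ ρ (g.mat 1) *
      linForm φ ρ (mulAlpha (cuspRow g.mat))).prod * φ X ^ 2) (denL l) := by
  induction l with
  | nil => simpa [denL] using isApprox_X_sq φ ρ
  | cons g l ih =>
    rw [List.map_cons, List.prod_cons, mul_assoc]
    refine IsApprox.mul hφ hρ (IsApprox.mul hφ hρ ?_ ?_) ih
    · exact isApprox_linForm hφ hρ (mat_one g)
    · exact isApprox_linForm hφ hρ (by rw [cuspRow_mat, mulAlpha_ofL])

theorem norm_listForm_eq (hφ : ‖φ X‖ = 3) (hρ : ρ ^ 2 + 1 = 0) :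
    ‖listForm φ ρ [2, 2, 2] [2, 0, 0]‖ = 3 ^ 2 := by
  have hx : (ofL [2, 2, 2]).natDegree = 2 := by
    have : ofL [2, 2, 2] = -(X ^ 2 + X + 1) := by
      simp only [ofL]
      push_cast
      rw [C_two_eq_neg_one]
      ring
    rw [this, natDegree_neg]
    compute_degree!
  have hy : (ofL [2, 0, 0]).natDegree = 0 := by simp [ofL]
  rw [listForm, norm_map_mul_add_map hφ hρ, hx, hy]
  · rfl
  · left
    intro h
    simp [h] at hx

/-- Elements with approximations differing by a factor `T ^ 3` have quotient close to `T ^ (-3)`. -/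
theorem norm_div_sub_le (hφ : ‖φ X‖ = 3) {n : ℕ} {x y : List ℕ}
    (hxy : ‖listForm φ ρ x y‖ = 3 ^ 2) {z w : K} (hz : IsApprox φ ρ z (n, x, y))
    (hw : IsApprox φ ρ w (n + 3, x, y)) : ‖z / w - (φ X)⁻¹ ^ 3‖ ≤ 3 ^ (-6 : ℤ) := by
  have hz := hz.1
  have hw := hw.1
  simp only at hz hw
  set W := listForm φ ρ x y
  have ht : φ X ≠ 0 := by rw [← norm_ne_zero_iff, hφ]; norm_num
  have hn : (0 : ℝ) < 3 ^ n := by positivity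
  have hw1 : ‖φ X ^ (n + 3) * W‖ = 3 ^ n * 3 ^ 5 := by
    rw [norm_mul, norm_pow, hφ, hxy]; ring
  rw [pow_add 3 n 3] at hw
  have hw2 : ‖w‖ = 3 ^ n * 3 ^ 5 := by
    have : ‖w - φ X ^ (n + 3) * W‖ < ‖φ X ^ (n + 3) * W‖ := by rw [hw1]; linarith
    rw [← sub_add_cancel w (φ X ^ (n + 3) * W),
      IsUltrametricDist.norm_add_eq_max_of_norm_ne_norm this.ne, max_eq_right this.le, hw1]
  have hw0 : w ≠ 0 := by rw [← norm_ne_zero_iff, hw2]; positivity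
  have key : z / w - (φ X)⁻¹ ^ 3 =
      (φ X ^ 3 * (z - φ X ^ n * W) - (w - φ X ^ (n + 3) * W)) / (φ X ^ 3 * w) := by
    field_simp
    ring
  rw [key, norm_div, norm_mul, norm_pow, hφ, hw2]
  have h1 : ‖φ X ^ 3 * (z - φ X ^ n * W) - (w - φ X ^ (n + 3) * W)‖ ≤ 3 ^ n * 3 ^ 2 := by
    rw [sub_eq_add_neg]
    refine (IsUltrametricDist.norm_add_le_max _ _).trans (max_le ?_ ?_)
    · rw [norm_mul, norm_pow, hφ]
      linarith
    · rw [norm_neg]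
      linarith
  calc _ ≤ (3 : ℝ) ^ n * 3 ^ 2 / (3 ^ 3 * (3 ^ n * 3 ^ 5)) := by gcongr
    _ = 3 ^ (-6 : ℤ) := by field_simp

theorem norm_prod_cuspFactor_sub_le (hφ : ‖φ X‖ = 3) (hρ : ρ ^ 2 + 1 = 0) :
    ‖(codes.map fun g => cuspFactor φ ρ g.mat).prod - (φ X)⁻¹ ^ 3‖ ≤ 3 ^ (-6 : ℤ) := by
  have hnum := isApprox_numL hφ hρ codes
  have hden := isApprox_denL hφ hρ codes
  rw [numL_codes] at hnum
  rw [denL_codes] at hden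
  have h := norm_div_sub_le hφ (norm_listForm_eq hφ hρ) hnum hden
  have ht : φ X ^ 2 ≠ 0 := by
    refine pow_ne_zero _ ?_
    rw [← norm_ne_zero_iff, hφ]; norm_num
  rw [mul_div_mul_right _ _ ht] at h
  rw [← Multiset.prod_coe, ← Multiset.prod_coe, ← Multiset.map_coe, ← Multiset.map_coe,
    ← Multiset.prod_map_div, Multiset.map_coe, Multiset.prod_coe] at h
  exact h

theorem norm_prod_cuspFactor (hφ : ‖φ X‖ = 3) (hρ : ρ ^ 2 + 1 = 0) :
    ‖(codes.map fun g => cuspFactor φ ρ g.mat).prod‖ = 3 ^ (-3 : ℤ) := by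
  have h := norm_prod_cuspFactor_sub_le hφ hρ
  have h3 : ‖(φ X)⁻¹ ^ 3‖ = 3 ^ (-3 : ℤ) := by
    rw [norm_pow, norm_inv, hφ]; norm_num
  have h4 : ‖(codes.map fun g => cuspFactor φ ρ g.mat).prod - (φ X)⁻¹ ^ 3‖ < ‖(φ X)⁻¹ ^ 3‖ := by
    rw [h3]
    exact h.trans_lt (by norm_num)
  rw [← sub_add_cancel (codes.map fun g => cuspFactor φ ρ g.mat).prod ((φ X)⁻¹ ^ 3),
    IsUltrametricDist.norm_add_eq_max_of_norm_ne_norm h4.ne, max_eq_right h4.le, h3]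

/-- The product over `Γ / {±1}` of any function given by `cuspFactor`. -/
theorem multipliable_and_norm_tprod_sub_lt [CompleteSpace K] (hφ : ‖φ X‖ = 3)
    (hρ : ρ ^ 2 + 1 = 0) {f : Quotient pmSetoid → K}
    (hf : ∀ γ : Gamma0TTT, f (Quotient.mk pmSetoid γ) = cuspFactor φ ρ γ.1) :
    Multipliable f ∧ ‖∏' x, f x - (φ X)⁻¹ ^ 3‖ < 3 ^ (-5 : ℤ) := by
  have hmul : Multipliable f := by
    refine multipliable_of_finite_norm_sub_one fun ε hε => ?_
    obtain ⟨n, hn⟩ := exists_pow_lt_of_lt_one (show 0 < ε / 3 ^ 7 by positivity)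
      (show (1 / 3 : ℝ) < 1 by norm_num)
    have hfin := ((finite_size_le n).preimage Subtype.val_injective.injOn).image
      (Quotient.mk pmSetoid)
    refine hfin.subset fun x hx => ?_
    obtain ⟨γ, rfl⟩ := Quotient.exists_rep x
    refine ⟨γ, ?_, rfl⟩
    by_contra! h
    have h' : n ≤ size (γ.1 1) + size (mulAlpha (cuspRow γ.1)) := (not_le.1 h).le
    refine absurd (Set.mem_ofPred_eq ▸ hx : ε < ‖_‖) (not_lt.2 ?_)
    rw [hf]
    refine (norm_cuspFactor_sub_one_le hφ hρ γ.2).trans ?_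
    calc _ ≤ (3 : ℝ) ^ 7 / 3 ^ n := by gcongr; norm_num
      _ = 3 ^ 7 * (1 / 3) ^ n := by rw [div_pow, one_pow]; ring
      _ ≤ 3 ^ 7 * (ε / 3 ^ 7) := by gcongr
      _ = ε := by field_simp
  refine ⟨hmul, ?_⟩
  have hprod : ∏ x ∈ classes.toFinset, f x = (codes.map fun g => cuspFactor φ ρ g.mat).prod := by
    rw [List.prod_toFinset _ nodup_classes, classes, List.map_pmap]
    simp only [hf]
    rw [List.pmap_eq_map]
  have htail := norm_tprod_sub_prod_le hmul (r := 3 ^ (-3 : ℤ)) (by positivity) (by norm_num)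
    (s := classes.toFinset) (by
      intro x hx
      obtain ⟨γ, rfl⟩ := Quotient.exists_rep x
      rw [List.mem_toFinset] at hx
      have h : 10 ≤ size (γ.1 1) + size (mulAlpha (cuspRow γ.1)) := by
        by_contra! h
        exact hx (mk_mem_classes (Nat.lt_succ_iff.1 h))
      rw [hf]
      refine (norm_cuspFactor_sub_one_le hφ hρ γ.2).trans ?_
      calc _ ≤ (3 : ℝ) ^ 7 / 3 ^ 10 := by gcongr; norm_num
        _ = 3 ^ (-3 : ℤ) := by norm_num)
  rw [hprod, norm_prod_cuspFactor hφ hρ] at htail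
  rw [← sub_add_sub_cancel _ (codes.map fun g => cuspFactor φ ρ g.mat).prod]
  refine (IsUltrametricDist.norm_add_le_max _ _).trans_lt (max_lt ?_ ?_)
  · exact htail.trans_lt (by norm_num)
  · exact (norm_prod_cuspFactor_sub_le hφ hρ).trans_lt (by norm_num)

end Product

theorem norm_polyEmb3_X {C : Type*} [NormedField C] [Algebra (LaurentSeries (ZMod 3)) C]
    (hext : ∀ x : LaurentSeries (ZMod 3),
      ‖algebraMap (LaurentSeries (ZMod 3)) C x‖ = absK3 x) : ‖polyEmb3 C X‖ = 3 := by
  have h : polyEmb3 C X = algebraMap (LaurentSeries (ZMod 3)) C Tel3 := by simp [polyEmb3]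
  have h0 : Tel3 ≠ 0 := HahnSeries.single_ne_zero one_ne_zero
  rw [h, hext, absK3, if_neg h0, Tel3, HahnSeries.order_single one_ne_zero]
  norm_num

theorem sub_act3_div_sub_act3 {C : Type*} [NormedField C] [IsUltrametricDist C]
    [Algebra (LaurentSeries (ZMod 3)) C] (hX : ‖polyEmb3 C X‖ = 3) {ρ : C} (hρ : ρ ^ 2 + 1 = 0)
    {γ : Matrix (Fin 2) (Fin 2) (ZMod 3)[X]} (hγ : γ ∈ Gamma0TTT) :
    ((polyEmb3 C (X ^ 2 - X))⁻¹ - act3 γ ((polyEmb3 C X)⁻¹ ^ 2 * ρ)) /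
      ((polyEmb3 C (X ^ 2 - X))⁻¹ - act3 γ (act3 alpha3 ((polyEmb3 C X)⁻¹ ^ 2 * ρ))) =
    cuspFactor (polyEmb3 C) ρ γ := by
  have h1 := linForm_ne_zero hX hρ (row_ne_zero hγ)
  have h2 := linForm_ne_zero hX hρ (mulAlpha_ne_zero (row_ne_zero hγ))
  have h3 : linForm (polyEmb3 C) ρ (alpha3 1) ≠ 0 := by
    refine linForm_ne_zero hX hρ fun h => ?_
    have h' : (2 * X ^ 2 + 2 * X + 1 : (ZMod 3)[X]) = 0 := by simpa [alpha3] using congrFun h 1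
    simpa using congrArg (coeff · 0) h'
  have hM : polyEmb3 C (X ^ 2 - X) ≠ 0 := by
    rw [← norm_ne_zero_iff, norm_map_of_ne_zero hX X_sq_sub_X_ne_zero]
    positivity
  have ht : polyEmb3 C X ≠ 0 := by rw [← norm_ne_zero_iff, hX]; norm_num
  have hform (v : Fin 2 → (ZMod 3)[X]) : polyEmb3 C (v 0) * ((polyEmb3 C X)⁻¹ ^ 2 * ρ) +
      polyEmb3 C (v 1) = linForm (polyEmb3 C) ρ v / polyEmb3 C X ^ 2 := by
    rw [linForm, map_mul, map_pow]
    field_simp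
  have e1 : act3 γ ((polyEmb3 C X)⁻¹ ^ 2 * ρ) =
      linForm (polyEmb3 C) ρ (γ 0) / linForm (polyEmb3 C) ρ (γ 1) := by
    rw [act3, hform, hform, div_div_div_cancel_right₀ (pow_ne_zero _ ht)]
  have e2 : act3 alpha3 ((polyEmb3 C X)⁻¹ ^ 2 * ρ) =
      linForm (polyEmb3 C) ρ (alpha3 0) / linForm (polyEmb3 C) ρ (alpha3 1) := by
    rw [act3, hform, hform, div_div_div_cancel_right₀ (pow_ne_zero _ ht)]
  have e3 (v : Fin 2 → (ZMod 3)[X]) : linForm (polyEmb3 C) ρ (mulAlpha v) =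
      polyEmb3 C (v 0) * linForm (polyEmb3 C) ρ (alpha3 0) +
        polyEmb3 C (v 1) * linForm (polyEmb3 C) ρ (alpha3 1) := by
    simp only [linForm, mulAlpha, map_add, map_mul]
    ring
  have e4 : act3 γ (act3 alpha3 ((polyEmb3 C X)⁻¹ ^ 2 * ρ)) =
      linForm (polyEmb3 C) ρ (mulAlpha (γ 0)) / linForm (polyEmb3 C) ρ (mulAlpha (γ 1)) := by
    rw [e2, act3, e3, e3]
    field_simp
  have e5 : linForm (polyEmb3 C) ρ (cuspRow γ) = linForm (polyEmb3 C) ρ (γ 1) -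
      polyEmb3 C (X ^ 2 - X) * linForm (polyEmb3 C) ρ (γ 0) := by
    simp only [linForm, cuspRow, map_sub, map_mul]
    ring
  have e6 : linForm (polyEmb3 C) ρ (mulAlpha (cuspRow γ)) =
      linForm (polyEmb3 C) ρ (mulAlpha (γ 1)) -
        polyEmb3 C (X ^ 2 - X) * linForm (polyEmb3 C) ρ (mulAlpha (γ 0)) := by
    simp only [e3, cuspRow, map_sub, map_mul]
    ring
  have h4 := linForm_ne_zero hX hρ (mulAlpha_ne_zero (cuspRow_ne_zero hγ))
  rw [e4, e1, cuspFactor, e5]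
  have e7 : (polyEmb3 C (X ^ 2 - X))⁻¹ - linForm (polyEmb3 C) ρ (mulAlpha (γ 0)) /
      linForm (polyEmb3 C) ρ (mulAlpha (γ 1)) = linForm (polyEmb3 C) ρ (mulAlpha (cuspRow γ)) /
        (polyEmb3 C (X ^ 2 - X) * linForm (polyEmb3 C) ρ (mulAlpha (γ 1))) := by
    rw [e6]
    field_simp
  rw [e7]
  field_simp

/-- **Part of the Proposition in Section 8.2.**  With `ω = T⁻²·ρ` (`ρ² + 1 = 0`), the
family `γ ↦ (1/(T²-T) - γω)/(1/(T²-T) - γ(αω))`, indexed by `Γ~ = Γ/{±I}`, is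
multipliable, and its product `u_α(1/(T²-T))` satisfies `|u_α(1/(T²-T)) - π³| < 3⁻⁵`,
`π = 1/T`. -/
theorem u_alpha3_at_one_over_T_sq_sub_T {C : Type*} [NormedField C] [CompleteSpace C]
    [Algebra (LaurentSeries (ZMod 3)) C]
    (hna : ∀ x y : C, ‖x + y‖ ≤ max ‖x‖ ‖y‖)
    (hext : ∀ x : LaurentSeries (ZMod 3), ‖algebraMap (LaurentSeries (ZMod 3)) C x‖ = absK3 x)
    (ρ : C) (hρ : ρ ^ 2 + 1 = 0)
    (ω : C) (hω : ω = (polyEmb3 C Polynomial.X)⁻¹ ^ 2 * ρ)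
    (s : C) (hs : s = (polyEmb3 C (Polynomial.X ^ 2 - Polynomial.X))⁻¹)
    (f : Quotient pmSetoid → C)
    (hf : ∀ γ : ↥Gamma0TTT, f (Quotient.mk pmSetoid γ)
      = (s - act3 γ.val ω) / (s - act3 γ.val (act3 alpha3 ω))) :
    Multipliable f ∧
    ‖(∏' x, f x) - ((polyEmb3 C Polynomial.X)⁻¹ ^ 3)‖ < (3 : ℝ) ^ (-5 : ℤ) := by
  have : IsUltrametricDist C :=
    IsUltrametricDist.isUltrametricDist_of_forall_norm_add_le_max_norm hna
  subst hω hs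
  exact multipliable_and_norm_tprod_sub_lt (norm_polyEmb3_X hext) hρ fun γ =>
    (hf γ).trans (sub_act3_div_sub_act3 (norm_polyEmb3_X hext) hρ γ.2)
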